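/- For activated random walk on ℤ with simple symmetric nearest-neighbor jumps, the critical density satisfies ρ_c(ℤ, λ) = 1 − o(λ^{−n}) as λ → ∞ for every integer n ≥ 1; that is, for every n ≥ 1, λ^n · (1 − ρ_c(ℤ, λ)) → 0 as λ → ∞. -/

import Mathlib

/-!
Common framework for the activated random walk (ARW) model on `ℤ^d`,
via the site-wise (Diaconis–Fulton) representation.
-/

open MeasureTheory ENNReal Filter

namespace ARW

noncomputable section
open scoped Classical

/-- A site of the lattice `ℤ^d`. -/
abbrev Site (d : ℕ) := Fin d → ℤ

/-- An instruction: `none` is a sleep instruction, `some z` is a jump instruction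
with displacement `z`. -/
abbrev Instr (d : ℕ) := Option (Site d)

instance (d : ℕ) : MeasurableSpace (Instr d) := ⊤

/-- The array of instruction stacks: `I (x, k)` is the `k`-th instruction at site `x`. -/
abbrev Stacks (d : ℕ) := Site d × ℕ → Instr d

/-- The state of a site: `active n` means `n` active particles (and no sleeping one),
`sleeping` means a single sleeping particle. -/
inductive SiteState : Type
  | active : ℕ → SiteState
  | sleeping : SiteState
  deriving DecidableEq

/-- A particle configuration. -/
abbrev Config (d : ℕ) := Site d → SiteState

/-- Number of active particles at a site state. -/
def numActive : SiteState → ℕ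
  | .active n => n
  | .sleeping => 0

/-- Adding one (active) particle to a site: a sleeping particle is reactivated. -/
def addParticle : SiteState → SiteState
  | .active n => .active (n + 1)
  | .sleeping => .active 2

/-- A state of the system: a configuration together with an odometer
(number of instructions already used at each site). -/
abbrev State (d : ℕ) := Config d × (Site d → ℕ)

/-- Initial state on `V` obtained from an all-active particle count `η` (particles
outside `V` are discarded), with odometer `0`. -/
def initState (d : ℕ) (V : Finset (Site d)) (η : Site d → ℕ) : State d :=
  (fun x => .active (if x ∈ V then η x else 0), fun _ => 0)

/-- Toppling the site `x` (inside `V`, particles jumping out of `V` are killed):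
the next unused instruction at `x` is executed and the odometer at `x` increases by one.
A sleep instruction puts the particle at `x` to sleep if it is alone (otherwise it has
no effect), and a jump instruction moves one particle from `x` to `x + z`
(reactivating a sleeping particle there), killing it if `x + z ∉ V`. -/
def topple {d : ℕ} (V : Finset (Site d)) (I : Stacks d) (x : Site d) (s : State d) :
    State d :=
  let σ := s.1
  let m := s.2
  let σ' : Config d :=
    match I (x, m x) with
    | none => if numActive (σ x) = 1 then Function.update σ x .sleeping else σ
    | some z =>
        let σ₁ := Function.update σ x (SiteState.active (numActive (σ x) - 1))
        if x + z ∈ V then Function.update σ₁ (x + z) (addParticle (σ₁ (x + z))) else σ₁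
  (σ', Function.update m x (m x + 1))

/-- Running a sequence of topplings. -/
def run {d : ℕ} (V : Finset (Site d)) (I : Stacks d) : State d → List (Site d) → State d
  | s, [] => s
  | s, x :: l => run V I (topple V I x s) l

/-- Legality of a toppling sequence: every toppled site lies in `V` and holds at least one
active particle when toppled. -/
def Legal {d : ℕ} (V : Finset (Site d)) (I : Stacks d) : State d → List (Site d) → Prop
  | _, [] => True
  | s, x :: l => x ∈ V ∧ 1 ≤ numActive (s.1 x) ∧ Legal V I (topple V I x s) l

/-- A configuration is stable in `V` if no site of `V` holds an active particle. -/
def Stable {d : ℕ} (V : Finset (Site d)) (σ : Config d) : Prop :=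
  ∀ x ∈ V, numActive (σ x) = 0

/-- The stabilization of `η` in `V` terminates. -/
def StabCompletes {d : ℕ} (V : Finset (Site d)) (I : Stacks d) (η : Site d → ℕ) : Prop :=
  ∃ l, Legal V I (initState d V η) l ∧ Stable V (run V I (initState d V η) l).1

/-- The stable configuration `Stab_V η` (well defined, independently of the chosen legal
toppling sequence, by the abelian property), when stabilization terminates. -/
def stabConfig {d : ℕ} (V : Finset (Site d)) (I : Stacks d) (η : Site d → ℕ) : Config d :=
  if h : StabCompletes V I η then (run V I (initState d V η) h.choose).1
  else fun _ => .active 0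

/-- The event `0 ∈ Stab_V η`: stabilization of `η` in `V` ends with a sleeping particle
at the origin. -/
def SleepAt0 {d : ℕ} (V : Finset (Site d)) (I : Stacks d) (η : Site d → ℕ) : Prop :=
  StabCompletes V I η ∧ stabConfig V I η 0 = .sleeping

/-- The event `0 ∉ Stab_V η`: stabilization of `η` in `V` ends with the origin empty. -/
def EmptyAt0 {d : ℕ} (V : Finset (Site d)) (I : Stacks d) (η : Site d → ℕ) : Prop :=
  StabCompletes V I η ∧ stabConfig V I η 0 ≠ .sleeping

/-- The limiting odometer of `η` at the origin: the supremum, over finite volumes `V` and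
legal toppling sequences in `V`, of the number of topplings performed at the origin. -/
def odom0 {d : ℕ} (I : Stacks d) (η : Site d → ℕ) : ℕ∞ :=
  ⨆ (V : Finset (Site d)) (l : List (Site d)) (_ : Legal V I (initState d V η) l),
    (l.count 0 : ℕ∞)

/-! ### The random instructions -/

/-- The normalized sleep rate `λ_s = λ/(1+λ)`. -/
def lamS (lam : ℝ) : ℝ := lam / (1 + lam)

/-- The normalized jump rate `λ_J = 1/(1+λ)`. -/
def lamJ (lam : ℝ) : ℝ := 1 / (1 + lam)

/-- The distribution of a single instruction: sleep with probability `λ_s`, jump by `z`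
with probability `λ_J · step z`. -/
def instrWeight {d : ℕ} (step : Site d → ℝ) (lam : ℝ) : Instr d → ℝ≥0∞
  | none => ENNReal.ofReal (lamS lam)
  | some z => ENNReal.ofReal (lamJ lam) * ENNReal.ofReal (step z)

/-- `μ` is the law of the i.i.d. instruction stacks: a probability measure whose
finite-dimensional cylinder probabilities are the products of the `instrWeight`s. -/
def IsStackLaw (d : ℕ) (step : Site d → ℝ) (lam : ℝ) (μ : Measure (Stacks d)) : Prop :=
  IsProbabilityMeasure μ ∧
    ∀ (F : Finset (Site d × ℕ)) (g : Site d × ℕ → Instr d),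
      μ {I | ∀ i ∈ F, I i = g i} = ∏ i ∈ F, instrWeight step lam (g i)

/-- The law of the i.i.d. instruction stacks (uniquely determined by its cylinder
probabilities; it exists whenever `step` is a probability distribution and `λ > 0`). -/
def stackLaw (d : ℕ) (step : Site d → ℝ) (lam : ℝ) : Measure (Stacks d) :=
  if h : ∃ μ, IsStackLaw d step lam μ then h.choose else 0

/-! ### Fixation and the critical density -/

/-- Translation of a particle count by `z`. -/
def shift {d : ℕ} (z : Site d) (η : Site d → ℕ) : Site d → ℕ := fun x => η (x + z)

/-- A translation-ergodic distribution of particles: invariant under all translations,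
and every translation-invariant event is trivial. -/
def IsTransErgodic {d : ℕ} (ν : Measure (Site d → ℕ)) : Prop :=
  (∀ z, Measure.map (shift z) ν = ν) ∧
    ∀ s : Set (Site d → ℕ), MeasurableSet s → (∀ z, shift z ⁻¹' s = s) → ν s = 0 ∨ ν s = 1

/-- Almost sure fixation of the initial distribution `ν`: for `ν`-almost every initial
configuration and almost every instructions, the limiting odometer at the origin is
finite (equivalently, by Amir–Gurel-Gurevich, every particle eventually sleeps forever). -/
def Fixates (d : ℕ) (step : Site d → ℝ) (lam : ℝ) (ν : Measure (Site d → ℕ)) : Prop :=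
  ∀ᵐ η ∂ν, ∀ᵐ I ∂(stackLaw d step lam), odom0 I η ≠ ⊤

/-- The critical density `ρ_c(ℤ^d, P, λ)`: the supremum of the densities `ρ` such that
every translation-ergodic probability distribution of active particles with mean `ρ`
particles per site fixates almost surely. -/
def critDensity (d : ℕ) (step : Site d → ℝ) (lam : ℝ) : ℝ :=
  sSup {ρ : ℝ | 0 ≤ ρ ∧
    ∀ ν : Measure (Site d → ℕ), IsProbabilityMeasure ν → IsTransErgodic ν →
      (∫⁻ η, (η 0 : ℝ≥0∞) ∂ν) = ENNReal.ofReal ρ → Fixates d step lam ν}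

/-! ### Random walk quantities -/

/-- Simple symmetric nearest-neighbour step distribution on `ℤ^d`. -/
def ssrwStep (d : ℕ) : Site d → ℝ :=
  fun z => if (∑ i, (z i).natAbs) = 1 then (1 : ℝ) / (2 * d) else 0

/-- `psum w k` : position after the first `k` steps with increments `w`. -/
def psum {d n : ℕ} (w : Fin n → Site d) (k : ℕ) : Site d :=
  ∑ i ∈ Finset.univ.filter (fun i : Fin n => (i : ℕ) < k), w i

/-- Probability of a given sequence of increments. -/
def pathProb {d n : ℕ} (step : Site d → ℝ) (w : Fin n → Site d) : ℝ := ∏ i, step (w i)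

/-- `P(S_n = 0)` for the discrete-time walk started at `0`. -/
def probAt0 {d : ℕ} (step : Site d → ℝ) (n : ℕ) : ℝ :=
  ∑' w : Fin n → Site d, if psum w n = 0 then pathProb step w else 0

/-- The Green's function `G = Σ_{n ≥ 0} P(S_n = 0)` of the walk, valued in `[0, ∞]`.
The walk is transient iff `greenE step < ∞`. -/
def greenE {d : ℕ} (step : Site d → ℝ) : ℝ≥0∞ :=
  ∑' n : ℕ, ENNReal.ofReal (probAt0 step n)

/-- Probability that the walk returns to `0` for the first time at time `n`, having
stayed inside `A` at all intermediate times. -/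
def returnIn {d : ℕ} (step : Site d → ℝ) (A : Set (Site d)) (n : ℕ) : ℝ :=
  ∑' w : Fin n → Site d,
    if (∀ k, 0 < k → k < n → psum w k ≠ 0 ∧ psum w k ∈ A) ∧ psum w n = 0
    then pathProb step w else 0

/-- `P(τ = n)` where `τ` is the first return time to the origin. -/
def firstReturn {d : ℕ} (step : Site d → ℝ) (n : ℕ) : ℝ := returnIn step Set.univ n

/-- The probability that the walk started at `0` exits `A` strictly before returning
to `0`. -/
def escProb {d : ℕ} (step : Site d → ℝ) (A : Set (Site d)) : ℝ :=
  ∑' n : ℕ, ∑' w : Fin (n + 1) → Site d,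
    if (∀ k, 0 < k → k ≤ n → psum w k ≠ 0 ∧ psum w k ∈ A) ∧ psum w (n + 1) ∉ A
    then pathProb step w else 0

/-- `q(ℤ^d, P, λ)`: the probability that a single particle started at the origin falls
asleep at the origin, i.e. that the walk is at `0` after `N` steps where
`P(N = n) = λ_s λ_J^n`. -/
def qProb {d : ℕ} (step : Site d → ℝ) (lam : ℝ) : ℝ :=
  ∑' n : ℕ, lamS lam * lamJ lam ^ n * probAt0 step n

/-- The ball `B_r = {x : ‖x‖₁ ≤ r}`. -/
def ball (d : ℕ) (r : ℝ) : Set (Site d) := {x | ((∑ i, (x i).natAbs : ℕ) : ℝ) ≤ r}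

/-- `η` fills `A`: at least one particle at each site of `A`. -/
def Fills {d : ℕ} (η : Site d → ℕ) (A : Set (Site d)) : Prop := ∀ x ∈ A, 1 ≤ η x

/-! ### Weak stabilization, strong stabilization and the number of chances -/

/-- Legality of a weak toppling sequence (with respect to the origin): off the origin as
usual, while the origin may only be toppled if it holds at least two active particles. -/
def WLegal {d : ℕ} (V : Finset (Site d)) (I : Stacks d) : State d → List (Site d) → Prop
  | _, [] => True
  | s, x :: l => x ∈ V ∧ (if x = 0 then 2 else 1) ≤ numActive (s.1 x) ∧
      WLegal V I (topple V I x s) l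

/-- Weak stability in `V` with respect to the origin. -/
def WStable {d : ℕ} (V : Finset (Site d)) (σ : Config d) : Prop :=
  numActive (σ 0) ≤ 1 ∧ ∀ x ∈ V, x ≠ 0 → numActive (σ x) = 0

/-- The weak stabilization of a state (well defined by the abelian property whenever it
terminates). -/
def weakStab {d : ℕ} (V : Finset (Site d)) (I : Stacks d) (s : State d) : State d :=
  if h : ∃ l, WLegal V I s l ∧ WStable V (run V I s l).1 then run V I s h.choose else s

/-- The jump-out step: the particle at the origin is acceptably toppled (consuming
instructions at the origin, ignoring the sleep instructions) until it jumps out. -/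
def jumpOut {d : ℕ} (V : Finset (Site d)) (I : Stacks d) (s : State d) : State d :=
  if h : ∃ k, (I (0, s.2 0 + k)).isSome then
    let k := Nat.find h
    let z := (I (0, s.2 0 + k)).get (Nat.find_spec h)
    let σ₁ := Function.update s.1 0 (SiteState.active (numActive (s.1 0) - 1))
    let σ' := if (0 : Site d) + z ∈ V then
        Function.update σ₁ ((0 : Site d) + z) (addParticle (σ₁ ((0 : Site d) + z)))
      else σ₁
    (σ', Function.update s.2 0 (s.2 0 + k + 1))
  else s

/-- The states of the strong stabilization of `η` on `V` with respect to the origin via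
successive weak stabilizations: `procState j` is the state after the `(j+1)`-st weak
stabilization; as long as the origin holds an active particle, it is jumped out and the
configuration is weakly stabilized again. -/
def procState {d : ℕ} (V : Finset (Site d)) (I : Stacks d) (η : Site d → ℕ) :
    ℕ → State d
  | 0 => weakStab V I (initState d V η)
  | j + 1 =>
      let s := procState V I η j
      if 1 ≤ numActive (s.1 0) then weakStab V I (jumpOut V I s) else s

/-- The number of chances `Ch(η, V)`: the number of completed iterations of the strong
stabilization procedure, i.e. the first `j` such that the origin is empty after the
`(j+1)`-st weak stabilization. -/
def chances {d : ℕ} (V : Finset (Site d)) (I : Stacks d) (η : Site d → ℕ) : ℕ∞ :=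
  if h : ∃ j, numActive ((procState V I η j).1 0) = 0 then (Nat.find h : ℕ∞) else ⊤

/-- The `j`-th weakly stable configuration `η^W_j` (for `1 ≤ j`). -/
def weakConfig {d : ℕ} (V : Finset (Site d)) (I : Stacks d) (η : Site d → ℕ) (j : ℕ) :
    Config d :=
  (procState V I η (j - 1)).1

/-- The `j`-th sleep trial `b_j` (for `1 ≤ j`): whether the first instruction used in the
`j`-th jump-out step is a sleep instruction. -/
def sleepTrial {d : ℕ} (V : Finset (Site d)) (I : Stacks d) (η : Site d → ℕ) (j : ℕ) :
    Prop :=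
  I (0, (procState V I η (j - 1)).2 0) = none

/-- `a^n` for `n ∈ ℕ∞`, with `a^∞ = 0` (appropriate for `a < 1`). -/
def enpow (a : ℝ≥0∞) : ℕ∞ → ℝ≥0∞
  | ⊤ => 0
  | (n : ℕ) => a ^ n

end
end ARW

open MeasureTheory ENNReal Filter Topology ARW

namespace ARW
noncomputable section
open scoped Classical
set_option linter.unusedSimpArgs false
set_option linter.unnecessarySeqFocus false

variable {d : ℕ}

/-- own-site effect of an instruction. -/
def own (i : Instr d) (a : SiteState) : SiteState :=
  match i with
  | none => if numActive a = 1 then .sleeping else a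
  | some _ => .active (numActive a - 1)

/-- the instruction `i` at `x` sends a particle to `w`. -/
def hit (V : Finset (Site d)) (i : Instr d) (x w : Site d) : Prop :=
  i = some (w - x) ∧ w ∈ V

/-- the site-wise effect of toppling. -/
def act (V : Finset (Site d)) (i : Instr d) (x w : Site d) (a : SiteState) : SiteState :=
  if hit V i x w then addParticle (if w = x then own i a else a)
  else (if w = x then own i a else a)

/-- toppling with an explicit instruction. -/
def top (V : Finset (Site d)) (i : Instr d) (x : Site d) (s : State d) : State d :=
  (fun w => act V i x w (s.1 w), Function.update s.2 x (s.2 x + 1))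

lemma topple_eq (V : Finset (Site d)) (I : Stacks d) (x : Site d) (s : State d) :
    topple V I x s = top V (I (x, s.2 x)) x s := by
  unfold topple top
  refine Prod.ext ?_ rfl
  funext w
  simp only [act, hit]
  rcases h : I (x, s.2 x) with _ | z
  · by_cases hw : w = x
    · subst hw
      by_cases h1 : numActive (s.1 w) = 1 <;> simp [h1, own]
    · by_cases h1 : numActive (s.1 x) = 1 <;> simp [h1, hw]
  · have hz : (some z = some (w - x)) ↔ w = x + z := by
      constructor
      · intro h; have := Option.some.inj h; subst this; simp
      · rintro rfl; simp
    simp only [hz]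
    by_cases hw2 : w = x + z
    · subst hw2
      by_cases hV : x + z ∈ V
      · by_cases h0 : x + z = x
        · simp [hV, h0, own]
          rw [h0] at hV
          simp [hV]
        · simp [hV, h0]
      · by_cases h0 : x + z = x
        · simp [hV, h0, own]
          rw [h0] at hV; simp [hV]
        · simp [hV, h0]
    · by_cases hV : x + z ∈ V <;> by_cases h0 : w = x
      · subst h0
        simp [hV, hw2, own]
      · simp [hV, hw2, h0]
      · subst h0; simp [hV, hw2, own]
      · simp [hV, hw2, h0]

/-- number of particles. -/
def cnt : SiteState → ℕ
  | .active n => n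
  | .sleeping => 1

lemma numActive_add (a : SiteState) : numActive a ≤ numActive (addParticle a) := by
  cases a <;> simp [numActive, addParticle]

lemma one_le_add (a : SiteState) : 1 ≤ numActive (addParticle a) := by
  cases a <;> simp [numActive, addParticle]

lemma cnt_add (a : SiteState) : cnt (addParticle a) = cnt a + 1 := by
  cases a <;> simp [cnt, addParticle]

lemma own_add (i : Instr d) (a : SiteState) (h : 1 ≤ numActive a) :
    addParticle (own i a) = own i (addParticle a) := by
  rcases i with _ | z <;> rcases a with n | _ <;> simp [own, addParticle, numActive] at *
  · split_ifs with h1 <;> simp_all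
    omega
  · omega

lemma act_ne {V : Finset (Site d)} {i : Instr d} {x w : Site d} (h : w ≠ x) (a : SiteState) :
    act V i x w a = if hit V i x w then addParticle a else a := by
  simp [act, h]

lemma act_comm (V : Finset (Site d)) (i j : Instr d) {x y : Site d} (hxy : x ≠ y) (w : Site d)
    (a : SiteState) (hx : w = x → 1 ≤ numActive a) (hy : w = y → 1 ≤ numActive a) :
    act V j y w (act V i x w a) = act V i x w (act V j y w a) := by
  by_cases h1 : w = x
  · subst h1
    have h := own_add i a (hx rfl)
    rw [act_ne hxy, act_ne hxy]
    simp only [act]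
    split_ifs <;> simp_all
  · by_cases h2 : w = y
    · subst h2
      have h := own_add j a (hy rfl)
      rw [act_ne h1, act_ne h1]
      simp only [act]
      split_ifs <;> simp_all
    · simp only [act_ne h1, act_ne h2]
      split_ifs <;> simp_all

lemma topple_comm (V : Finset (Site d)) (I : Stacks d) {x y : Site d} (hxy : x ≠ y) (s : State d)
    (hx : 1 ≤ numActive (s.1 x)) (hy : 1 ≤ numActive (s.1 y)) :
    topple V I y (topple V I x s) = topple V I x (topple V I y s) := by
  simp only [topple_eq, top]
  refine Prod.ext ?_ ?_
  · funext w
    simp only [Function.update_of_ne hxy, Function.update_of_ne hxy.symm]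
    exact act_comm V _ _ hxy w _ (by rintro rfl; exact hx) (by rintro rfl; exact hy)
  · simp only [Function.update_of_ne hxy, Function.update_of_ne hxy.symm]
    rw [Function.update_comm hxy]

lemma numActive_topple_ne (V : Finset (Site d)) (I : Stacks d) {x y : Site d} (hxy : x ≠ y)
    (s : State d) : numActive (s.1 x) ≤ numActive ((topple V I y s).1 x) := by
  rw [topple_eq]
  simp only [top, act_ne hxy]
  split_ifs
  · exact numActive_add _
  · exact le_rfl

lemma run_append (V : Finset (Site d)) (I : Stacks d) (s : State d) (l l' : List (Site d)) :
    run V I s (l ++ l') = run V I (run V I s l) l' := by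
  induction l generalizing s with
  | nil => rfl
  | cons x l ih => exact ih _

lemma Legal_append (V : Finset (Site d)) (I : Stacks d) (s : State d) (l l' : List (Site d)) :
    Legal V I s (l ++ l') ↔ Legal V I s l ∧ Legal V I (run V I s l) l' := by
  induction l generalizing s with
  | nil => simp [Legal, run]
  | cons x l ih => simp [Legal, run, ih, and_assoc]

lemma run_odom (V : Finset (Site d)) (I : Stacks d) (s : State d) (l : List (Site d)) (y : Site d) :
    (run V I s l).2 y = s.2 y + l.count y := by
  induction l generalizing s with
  | nil => simp [run]
  | cons x l ih =>
    rw [run, ih, topple_eq]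
    simp only [top]
    by_cases h : y = x
    · subst h; simp; omega
    · have : ¬ x = y := fun h' => h h'.symm
      simp [h, List.count_cons, this]

lemma move_front (V : Finset (Site d)) (I : Stacks d) (x : Site d) (hxV : x ∈ V)
    (l : List (Site d)) : ∀ (s : State d), Legal V I s l → 1 ≤ numActive (s.1 x) → x ∈ l →
      Legal V I s (x :: l.erase x) ∧ run V I s (x :: l.erase x) = run V I s l := by
  induction l with
  | nil => intro s _ _ h; simp at h
  | cons y l ih =>
    intro s hl hx hmem
    by_cases h : y = x
    · subst h
      simpa using hl
    · have hmem' : x ∈ l := by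
        rcases List.mem_cons.1 hmem with h' | h'
        · exact absurd h'.symm h
        · exact h'
      have hne : x ≠ y := fun h' => h h'.symm
      obtain ⟨h1, h2⟩ := ih (topple V I y s) hl.2.2
        (hx.trans (numActive_topple_ne V I hne s)) hmem'
      have he : (y :: l).erase x = y :: l.erase x := by
        rw [List.erase_cons_tail]; simpa using h
      rw [he]
      have hc := topple_comm V I hne s hx hl.2.1
      refine ⟨⟨hxV, hx, hl.1, hl.2.1.trans (numActive_topple_ne V I h s), ?_⟩, ?_⟩
      · rw [hc]; exact h1.2.2
      · simp only [run] at h2 ⊢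
        rw [hc]; exact h2

lemma numActive_run_notmem (V : Finset (Site d)) (I : Stacks d) (x : Site d)
    (l : List (Site d)) : ∀ (s : State d), x ∉ l →
      numActive (s.1 x) ≤ numActive ((run V I s l).1 x) := by
  induction l with
  | nil => intro s _; exact le_rfl
  | cons y l ih =>
    intro s h
    have h1 : x ≠ y := fun h' => h (by simp [h'])
    exact (numActive_topple_ne V I h1 s).trans (ih _ (fun h' => h (by simp [h'])))

/-- abelian property. -/
lemma abelian (V : Finset (Site d)) (I : Stacks d) (l : List (Site d)) :
    ∀ (s : State d) (l' : List (Site d)), Legal V I s l → Legal V I s l' →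
      Stable V (run V I s l').1 →
      (∀ y, l.count y ≤ l'.count y) ∧
      (Stable V (run V I s l).1 → run V I s l = run V I s l') := by
  induction l with
  | nil =>
    intro s l' _ h' hs
    refine ⟨by simp, fun h0 => ?_⟩
    cases l' with
    | nil => rfl
    | cons x l' =>
      have := h0 x h'.1
      have h2 := h'.2.1
      simp only [run] at this
      omega
  | cons x l ih =>
    intro s l' hl hl' hs
    have hmem : x ∈ l' := by
      by_contra hx
      have h1 := numActive_run_notmem V I x l' s hx
      have h2 := hs x hl.1
      have := hl.2.1
      omega
    obtain ⟨h1, h2⟩ := move_front V I x hl.1 l' s hl' hl.2.1 hmem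
    have hs' : Stable V (run V I (topple V I x s) (l'.erase x)).1 := by
      have : run V I (topple V I x s) (l'.erase x) = run V I s l' := h2
      rw [this]; exact hs
    obtain ⟨h3, h4⟩ := ih (topple V I x s) (l'.erase x) hl.2.2 h1.2.2 hs'
    refine ⟨fun y => ?_, fun h => ?_⟩
    · have := h3 y
      have hp := (List.perm_cons_erase hmem).count_eq y
      rw [hp]
      simp only [List.count_cons]
      omega
    · rw [← h2]
      exact h4 h

/-! ### Monotonicity -/

/-- rank of a site state. -/
def rank : SiteState → ℕ
  | .active 0 => 0
  | .sleeping => 1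
  | .active (n+1) => n + 2

lemma rank_add_mono {a b : SiteState} (h : rank a ≤ rank b) :
    rank (addParticle a) ≤ rank (addParticle b) := by
  rcases a with (_ | n) | _ <;> rcases b with (_ | m) | _ <;> simp [rank, addParticle] at * <;> omega

lemma rank_le_add (a : SiteState) : rank a ≤ rank (addParticle a) := by
  rcases a with (_ | n) | _ <;> simp [rank, addParticle]

lemma rank_own_mono (i : Instr d) {a b : SiteState} (h : rank a ≤ rank b) (h1 : 1 ≤ numActive a) :
    rank (own i a) ≤ rank (own i b) := by
  rcases i with _ | z <;> rcases a with (_ | _ | n) | _ <;> rcases b with (_ | _ | m) | _ <;>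
    simp [rank, own, numActive] at * <;> omega

lemma numActive_rank {a b : SiteState} (h : rank a ≤ rank b) : numActive a ≤ numActive b := by
  rcases a with (_ | n) | _ <;> rcases b with (_ | m) | _ <;> simp [rank, numActive] at * <;> omega

lemma legal_mono {V V' : Finset (Site d)} (hV : V ⊆ V') (I : Stacks d) (l : List (Site d)) :
    ∀ (s s' : State d), s.2 = s'.2 → (∀ x, rank (s.1 x) ≤ rank (s'.1 x)) → Legal V I s l →
      Legal V' I s' l := by
  induction l with
  | nil => intros; trivial
  | cons x l ih =>
    intro s s' h2 h1 hl
    refine ⟨hV hl.1, hl.2.1.trans (numActive_rank (h1 x)), ih _ _ ?_ ?_ hl.2.2⟩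
    · simp [topple_eq, top, h2]
    · intro w
      simp only [topple_eq, top, h2]
      have hb : rank (if w = x then own (I (x, s'.2 x)) (s.1 w) else s.1 w) ≤
          rank (if w = x then own (I (x, s'.2 x)) (s'.1 w) else s'.1 w) := by
        split_ifs with hw
        · subst hw; exact rank_own_mono _ (h1 w) hl.2.1
        · exact h1 w
      unfold act
      by_cases hh : hit V (I (x, s'.2 x)) x w
      · have hh' : hit V' (I (x, s'.2 x)) x w := ⟨hh.1, hV hh.2⟩
        rw [if_pos hh, if_pos hh']
        exact rank_add_mono hb
      · rw [if_neg hh]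
        by_cases hh' : hit V' (I (x, s'.2 x)) x w
        · rw [if_pos hh']; exact hb.trans (rank_le_add _)
        · rw [if_neg hh']; exact hb

lemma legal_init_mono {V V' : Finset (Site d)} (hV : V ⊆ V') (I : Stacks d) (η : Site d → ℕ)
    (l : List (Site d)) (h : Legal V I (initState d V η) l) :
    Legal V' I (initState d V' η) l := by
  refine legal_mono hV I l (initState d V η) _ rfl (fun x => ?_) h
  simp only [initState]
  by_cases hx : x ∈ V
  · simp [hx, hV hx]
  · simp [hx, rank]

end
end ARW

namespace ARW
noncomputable section
open scoped Classical
set_option linter.unusedSimpArgs false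
set_option linter.unnecessarySeqFocus false

variable {d : ℕ}

/-- number of jumps `z` among the first `m` instructions at `y`. -/
def nj (I : Stacks d) (y z : Site d) (m : ℕ) : ℕ :=
  ((Finset.range m).filter (fun k => I (y, k) = some z)).card

lemma nj_zero (I : Stacks d) (y z : Site d) : nj I y z 0 = 0 := by simp [nj]

lemma nj_succ (I : Stacks d) (y z : Site d) (m : ℕ) :
    nj I y z (m + 1) = nj I y z m + if I (y, m) = some z then 1 else 0 := by
  unfold nj
  rw [Finset.range_add_one, Finset.filter_insert]
  split_ifs with h
  · rw [Finset.card_insert_of_notMem (by simp)]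
  · simp

lemma nj_mono (I : Stacks d) (y z : Site d) {m m' : ℕ} (h : m ≤ m') : nj I y z m ≤ nj I y z m' := by
  unfold nj
  exact Finset.card_le_card (Finset.filter_subset_filter _ (Finset.range_mono h))

lemma cnt_own (i : Instr d) (a : SiteState) : cnt a ≤ cnt (own i a) + 1 := by
  rcases i with _ | z <;> rcases a with n | _ <;> simp [own, cnt, numActive]
  · split_ifs <;> simp_all [cnt]
  · omega

lemma cnt_act (V : Finset (Site d)) (i : Instr d) (x w : Site d) (a : SiteState) :
    cnt (act V i x w a) =
      cnt (if w = x then own i a else a) + if hit V i x w then 1 else 0 := by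
  unfold act
  split_ifs <;> simp [cnt_add]

lemma flow_run (V : Finset (Site d)) (I : Stacks d) (y w : Site d) (hw : w ∈ V) (hwy : w ≠ y)
    (l : List (Site d)) : ∀ s : State d, nj I y (w - y) (s.2 y) ≤ cnt (s.1 w) + s.2 w →
      nj I y (w - y) ((run V I s l).2 y) ≤ cnt ((run V I s l).1 w) + (run V I s l).2 w := by
  induction l with
  | nil => intro s h; exact h
  | cons x l ih =>
    intro s h
    refine ih _ ?_
    simp only [topple_eq, top]
    rw [cnt_act]
    by_cases h1 : y = x
    · subst h1
      simp only [Function.update_self, nj_succ, Function.update_of_ne hwy, if_neg hwy, hit, hw,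
        and_true]
      omega
    · simp only [Function.update_of_ne h1]
      by_cases h2 : w = x
      · subst h2
        have := cnt_own (I (w, s.2 w)) (s.1 w)
        simp only [Function.update_self, if_true]
        omega
      · simp only [Function.update_of_ne h2, if_neg h2]
        omega

lemma numActive_own (i : Instr d) (a : SiteState) (k : ℕ) (h : k + 2 ≤ numActive a) :
    k + 1 ≤ numActive (own i a) := by
  rcases i with _ | z
  · have : numActive a ≠ 1 := by omega
    simp only [own, if_neg this]; omega
  · simp only [own]
    change k + 1 ≤ numActive a - 1
    omega

lemma numActive_act_self (V : Finset (Site d)) (i : Instr d) (x : Site d) (a : SiteState) (k : ℕ)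
    (h : k + 2 ≤ numActive a) : k + 1 ≤ numActive (act V i x x a) := by
  unfold act
  have := numActive_own i a k h
  rw [if_pos (rfl : x = x)]
  split_ifs
  · exact this.trans (numActive_add _)
  · exact this

lemma legal_replicate (V : Finset (Site d)) (I : Stacks d) (w : Site d) (hw : w ∈ V) (k : ℕ) :
    ∀ s : State d, k + 1 ≤ numActive (s.1 w) → Legal V I s (List.replicate k w) := by
  induction k with
  | zero => intros; trivial
  | succ k ih =>
    intro s h
    refine ⟨hw, by omega, ih _ ?_⟩
    simp only [topple_eq, top]
    exact numActive_act_self V _ w _ k h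

/-- if many jumps to `w` have been performed, one may topple `w` many times. -/
lemma flow_extend (V : Finset (Site d)) (I : Stacks d) (η : Site d → ℕ) (y w : Site d)
    (hw : w ∈ V) (hwy : w ≠ y) (l : List (Site d)) (hl : Legal V I (initState d V η) l) :
    ∃ l', Legal V I (initState d V η) l' ∧ nj I y (w - y) (l.count y) ≤ l'.count w + 1 := by
  have h := flow_run V I y w hw hwy l (initState d V η) (by simp [initState, nj_zero])
  simp only [run_odom] at h
  have e0 : ∀ z, (initState d V η).2 z = 0 := fun z => rfl
  simp only [e0, zero_add] at h
  set s := run V I (initState d V η) l with hs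
  by_cases h2 : 2 ≤ cnt (s.1 w)
  · have h3 : cnt (s.1 w) = numActive (s.1 w) := by
      rcases hsw : s.1 w with n | _
      · rfl
      · rw [hsw] at h2; simp [cnt] at h2
    refine ⟨l ++ List.replicate (cnt (s.1 w) - 1) w, ?_, ?_⟩
    · rw [Legal_append]
      exact ⟨hl, legal_replicate V I w hw _ s (by omega)⟩
    · simp only [List.count_append, List.count_replicate_self]
      omega
  · exact ⟨l, hl, by omega⟩

/-! conservation -/

lemma cnt_act_legal (V : Finset (Site d)) (i : Instr d) (x w : Site d) (a : SiteState)
    (h : w = x → 1 ≤ numActive a) :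
    cnt (act V i x w a) + (if w = x then (if i = none then 0 else 1) else 0) =
      cnt a + if hit V i x w then 1 else 0 := by
  rw [cnt_act]
  by_cases hw : w = x
  · subst hw
    have h' := h rfl
    rcases i with _ | z <;> rcases a with n | _ <;> simp [own, cnt, numActive] at *
    · split_ifs with h1 <;> simp [cnt, h1]
    · omega
  · simp [hw]

lemma sum_cnt_top (V : Finset (Site d)) (i : Instr d) (x : Site d) (hx : x ∈ V) (σ : Config d)
    (h : 1 ≤ numActive (σ x)) :
    ∑ w ∈ V, cnt (act V i x w (σ w)) + (if ∃ z, i = some z ∧ x + z ∉ V then 1 else 0)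
      = ∑ w ∈ V, cnt (σ w) := by
  have h1 := Finset.sum_congr (rfl : V = V) (fun w _ =>
    cnt_act_legal V i x w (σ w) (by rintro rfl; exact h))
  rw [Finset.sum_add_distrib, Finset.sum_add_distrib] at h1
  rw [Finset.sum_ite_eq' V x, if_pos hx] at h1
  rcases i with _ | z
  · simp [hit] at h1 ⊢
    exact h1
  · have h2 : ∑ w ∈ V, (if hit V (some z) x w then 1 else 0) = if x + z ∈ V then 1 else 0 := by
      rw [← Finset.sum_ite_eq' V (x + z) (fun _ => 1)]
      refine Finset.sum_congr rfl fun w hw => ?_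
      have : hit V (some z) x w ↔ w = x + z := by
        unfold hit
        constructor
        · rintro ⟨h, _⟩; have := Option.some.inj h; subst this; simp
        · rintro rfl; simp [hw]
      simp [this]
    rw [h2] at h1
    by_cases hz : x + z ∈ V
    · simp [hz] at h1 ⊢; omega
    · simp [hz] at h1 ⊢; omega

/-- conservation with loss counted along jumps out of `V` from `y` with step `z`. -/
lemma cons_run (V : Finset (Site d)) (I : Stacks d) (y z : Site d) (hz : y + z ∉ V)
    (N : ℕ) (l : List (Site d)) : ∀ s : State d, Legal V I s l →
      nj I y z (s.2 y) + ∑ w ∈ V, cnt (s.1 w) ≤ N →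
      nj I y z ((run V I s l).2 y) + ∑ w ∈ V, cnt ((run V I s l).1 w) ≤ N := by
  induction l with
  | nil => intro s _ h; exact h
  | cons x l ih =>
    intro s hl h
    refine ih _ hl.2.2 ?_
    have h1 := sum_cnt_top V (I (x, s.2 x)) x hl.1 s.1 hl.2.1
    simp only [topple_eq, top]
    by_cases hxy : y = x
    · subst hxy
      simp only [Function.update_self, nj_succ]
      by_cases hI : I (y, s.2 y) = some z
      · have : ∃ z', I (y, s.2 y) = some z' ∧ y + z' ∉ V := ⟨z, hI, hz⟩
        simp only [if_pos this] at h1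
        simp only [if_pos hI]
        omega
      · simp only [if_neg hI]; omega
    · simp only [Function.update_of_ne hxy]
      omega

lemma sum_cnt_run_le (V : Finset (Site d)) (I : Stacks d) (l : List (Site d)) :
    ∀ s : State d, Legal V I s l →
      ∑ w ∈ V, cnt ((run V I s l).1 w) ≤ ∑ w ∈ V, cnt (s.1 w) := by
  induction l with
  | nil => intro s _; exact le_rfl
  | cons x l ih =>
    intro s hl
    refine (ih _ hl.2.2).trans ?_
    have h1 := sum_cnt_top V (I (x, s.2 x)) x hl.1 s.1 hl.2.1
    simp only [topple_eq, top]
    omega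

lemma sum_cnt_init (V : Finset (Site d)) (η : Site d → ℕ) :
    ∑ w ∈ V, cnt ((initState d V η).1 w) = ∑ w ∈ V, η w := by
  refine Finset.sum_congr rfl fun w hw => ?_
  simp [initState, cnt, hw]

/-! dimension one -/

/-- the point `k` of the one-dimensional lattice. -/
def pt (k : ℤ) : Site 1 := fun _ => k

lemma pt_inj : Function.Injective pt := fun _ _ h => congrFun h 0

lemma pt_apply (x : Site 1) : pt (x 0) = x := by
  funext i; fin_cases i; rfl

lemma pt_add (a b : ℤ) : pt (a + b) = pt a + pt b := rfl

lemma site_ext {x y : Site 1} (h : x 0 = y 0) : x = y := by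
  rw [← pt_apply x, ← pt_apply y, h]

/-- the interval `[-L, L]`. -/
def bx (L : ℕ) : Finset (Site 1) := (Finset.Icc (-(L : ℤ)) L).map ⟨pt, pt_inj⟩

lemma mem_bx {L : ℕ} {x : Site 1} : x ∈ bx L ↔ -(L : ℤ) ≤ x 0 ∧ x 0 ≤ L := by
  simp only [bx, Finset.mem_map, Finset.mem_Icc, Function.Embedding.coeFn_mk]
  constructor
  · rintro ⟨a, h, rfl⟩; exact h
  · intro h; exact ⟨x 0, h, pt_apply x⟩

lemma card_bx (L : ℕ) : (bx L).card = 2 * L + 1 := by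
  simp [bx]; omega

lemma bx_mono {L M : ℕ} (h : L ≤ M) : bx L ⊆ bx M := by
  intro x hx
  rw [mem_bx] at *
  omega

/-- regular instruction stacks. -/
def Reg (I : Stacks 1) : Prop :=
  (∀ p, I p = none ∨ I p = some (pt 1) ∨ I p = some (pt (-1))) ∧
  ∀ y z, (z = pt 1 ∨ z = pt (-1)) → ∀ K, ∃ k, K ≤ k ∧ I (y, k) = some z

lemma Reg.nj_large {I : Stacks 1} (h : Reg I) (y z : Site 1) (hz : z = pt 1 ∨ z = pt (-1)) (K : ℕ) :
    ∃ m, K ≤ nj I y z m := by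
  induction K with
  | zero => exact ⟨0, Nat.zero_le _⟩
  | succ K ih =>
    obtain ⟨m, hm⟩ := ih
    obtain ⟨k, hk, hI⟩ := h.2 y z hz m
    refine ⟨k + 1, ?_⟩
    rw [nj_succ, if_pos hI]
    have := nj_mono I y z hk
    omega

/-- the number of topplings at `y` in `V` is bounded. -/
def Bdd (V : Finset (Site 1)) (I : Stacks 1) (η : Site 1 → ℕ) (y : Site 1) : Prop :=
  ∃ B, ∀ l, Legal V I (initState 1 V η) l → l.count y ≤ B

lemma pt_one_ne : ∀ y : Site 1, y + pt 1 ≠ y := by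
  intro y h
  have := congrFun h 0
  simp [pt] at this

lemma bdd_step {V : Finset (Site 1)} {I : Stacks 1} (hI : Reg I) (η : Site 1 → ℕ) (y : Site 1)
    (h : y + pt 1 ∈ V → Bdd V I η (y + pt 1)) : Bdd V I η y := by
  by_cases hy : y + pt 1 ∈ V
  · obtain ⟨B, hB⟩ := h hy
    obtain ⟨K, hK⟩ := hI.nj_large y (pt 1) (Or.inl rfl) (B + 2)
    refine ⟨K, fun l hl => ?_⟩
    by_contra hc
    push Not at hc
    obtain ⟨l', h1, h2⟩ := flow_extend V I η y (y + pt 1) hy (pt_one_ne y) l hl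
    have h3 := hB l' h1
    have h4 := nj_mono I y (pt 1) hc.le
    simp only [add_sub_cancel_left] at h2
    omega
  · obtain ⟨K, hK⟩ := hI.nj_large y (pt 1) (Or.inl rfl) (∑ w ∈ V, η w + 1)
    refine ⟨K, fun l hl => ?_⟩
    by_contra hc
    push Not at hc
    have h1 := cons_run V I y (pt 1) hy (∑ w ∈ V, η w) l _ hl
      (by rw [sum_cnt_init]; simp [initState, nj_zero])
    rw [run_odom] at h1
    have e0 : ∀ z, (initState 1 V η).2 z = 0 := fun z => rfl
    rw [e0, zero_add] at h1
    have h4 := nj_mono I y (pt 1) hc.le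
    omega

lemma bdd_all {L : ℕ} {I : Stacks 1} (hI : Reg I) (η : Site 1 → ℕ) :
    ∀ y, Bdd (bx L) I η y := by
  have key : ∀ k : ℕ, ∀ y : Site 1, (L : ℤ) - y 0 < k → Bdd (bx L) I η y := by
    intro k
    induction k with
    | zero =>
      intro y hy
      refine bdd_step hI η y (fun h => ?_)
      rw [mem_bx] at h
      simp [pt] at h hy
      omega
    | succ k ih =>
      intro y hy
      refine bdd_step hI η y (fun h => ih _ ?_)
      simp [pt] at hy ⊢
      omega
  intro y
  refine key ((L : ℤ) - y 0 + 1).toNat y ?_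
  omega

lemma legal_mem {V : Finset (Site d)} {I : Stacks d} (l : List (Site d)) :
    ∀ s : State d, Legal V I s l → ∀ x ∈ l, x ∈ V := by
  induction l with
  | nil => intro s _ x hx; simp at hx
  | cons y l ih =>
    intro s hl x hx
    rcases List.mem_cons.1 hx with rfl | h
    · exact hl.1
    · exact ih _ hl.2.2 x h

lemma length_bdd {L : ℕ} {I : Stacks 1} (hI : Reg I) (η : Site 1 → ℕ) :
    ∃ B, ∀ l, Legal (bx L) I (initState 1 (bx L) η) l → l.length ≤ B := by
  choose B hB using bdd_all (L := L) hI η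
  refine ⟨∑ y ∈ bx L, B y, fun l hl => ?_⟩
  have h1 : l.length = ∑ y ∈ bx L, l.count y := by
    have := Multiset.sum_count_eq_card (s := bx L) (m := (l : Multiset (Site 1)))
      (fun a ha => legal_mem l _ hl a (by simpa using ha))
    simpa using this.symm
  rw [h1]
  exact Finset.sum_le_sum fun y _ => hB y l hl

lemma exists_stab {L : ℕ} {I : Stacks 1} (hI : Reg I) (η : Site 1 → ℕ) :
    ∃ l, Legal (bx L) I (initState 1 (bx L) η) l ∧
      Stable (bx L) (run (bx L) I (initState 1 (bx L) η) l).1 := by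
  obtain ⟨B, hB⟩ := length_bdd (L := L) hI η
  by_contra hc
  push Not at hc
  have : ∀ k, ∃ l, Legal (bx L) I (initState 1 (bx L) η) l ∧ l.length = k := by
    intro k
    induction k with
    | zero => exact ⟨[], trivial, rfl⟩
    | succ k ih =>
      obtain ⟨l, hl, hk⟩ := ih
      have := hc l hl
      unfold Stable at this
      push Not at this
      obtain ⟨x, hx, h0⟩ := this
      refine ⟨l ++ [x], ?_, by simp [hk]⟩
      rw [Legal_append]
      exact ⟨hl, hx, by omega, trivial⟩
  obtain ⟨l, hl, hk⟩ := this (B + 1)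
  have := hB l hl
  omega

/-- loss through the boundary. -/
lemma loss_run {L : ℕ} {I : Stacks 1} (hI : Reg I) (N : ℕ) (l : List (Site 1)) :
    ∀ s : State 1, Legal (bx L) I s l →
      N ≤ ∑ w ∈ bx L, cnt (s.1 w) + s.2 (pt L) + s.2 (pt (-L)) →
      N ≤ ∑ w ∈ bx L, cnt ((run (bx L) I s l).1 w) + (run (bx L) I s l).2 (pt L)
        + (run (bx L) I s l).2 (pt (-L)) := by
  induction l with
  | nil => intro s _ h; exact h
  | cons x l ih =>
    intro s hl h
    refine ih _ hl.2.2 ?_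
    have h1 := sum_cnt_top (bx L) (I (x, s.2 x)) x hl.1 s.1 hl.2.1
    have hm : ∀ y, s.2 y ≤ Function.update s.2 x (s.2 x + 1) y := by
      intro y
      by_cases hy : y = x
      · subst hy; simp
      · simp [hy]
    have hp := hm (pt L)
    have hq := hm (pt (-L))
    simp only [topple_eq, top]
    by_cases hz : ∃ z, I (x, s.2 x) = some z ∧ x + z ∉ bx L
    · rw [if_pos hz] at h1
      obtain ⟨z, hz1, hz2⟩ := hz
      have hx := mem_bx.1 hl.1
      have hxe : x = pt L ∨ x = pt (-L) := by
        have hz3 : z = pt 1 ∨ z = pt (-1) := by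
          rcases hI.1 (x, s.2 x) with h' | h' | h'
          · rw [h'] at hz1; simp at hz1
          · rw [h'] at hz1; left; exact (Option.some.inj hz1).symm
          · rw [h'] at hz1; right; exact (Option.some.inj hz1).symm
        rw [mem_bx] at hz2
        rcases hz3 with rfl | rfl
        · left; apply site_ext; simp [pt] at hz2 ⊢; omega
        · right; apply site_ext; simp [pt] at hz2 ⊢; omega
      have : s.2 (pt L) + s.2 (pt (-L)) + 1 ≤ Function.update s.2 x (s.2 x + 1) (pt L) +
          Function.update s.2 x (s.2 x + 1) (pt (-L)) := by
        rcases hxe with rfl | rfl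
        · have e : Function.update s.2 (pt L) (s.2 (pt L) + 1) (pt L) = s.2 (pt L) + 1 := by simp
          omega
        · have e : Function.update s.2 (pt (-L)) (s.2 (pt (-L)) + 1) (pt (-L))
            = s.2 (pt (-L)) + 1 := by simp
          omega
      omega
    · rw [if_neg hz] at h1
      omega

/-! infinite-volume odometer at a site -/

/-- odometer at a general site. -/
def odomAt (x : Site d) (I : Stacks d) (η : Site d → ℕ) : ℕ∞ :=
  ⨆ (V : Finset (Site d)) (l : List (Site d)) (_ : Legal V I (initState d V η) l),
    (l.count x : ℕ∞)

lemma odom0_eq (I : Stacks d) (η : Site d → ℕ) : odom0 I η = odomAt 0 I η := rfl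

lemma le_odomAt {x : Site d} {I : Stacks d} {η : Site d → ℕ} {V : Finset (Site d)}
    {l : List (Site d)} (h : Legal V I (initState d V η) l) : (l.count x : ℕ∞) ≤ odomAt x I η :=
  le_iSup_of_le V (le_iSup_of_le l (le_iSup_of_le h le_rfl))

lemma lt_odomAt {x : Site d} {I : Stacks d} {η : Site d → ℕ} {k : ℕ∞} :
    k < odomAt x I η ↔ ∃ V l, Legal V I (initState d V η) l ∧ k < (l.count x : ℕ∞) := by
  simp only [odomAt, lt_iSup_iff, exists_prop]

lemma odomAt_step {I : Stacks 1} (hI : Reg I) (η : Site 1 → ℕ) (y z : Site 1)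
    (hz : z = pt 1 ∨ z = pt (-1)) (h : odomAt y I η = ⊤) : odomAt (y + z) I η = ⊤ := by
  rw [ENat.eq_top_iff_forall_gt]
  intro B
  obtain ⟨K, hK⟩ := hI.nj_large y z hz (B + 2)
  have h1 : (K : ℕ∞) < odomAt y I η := by rw [h]; exact ENat.natCast_lt_top K
  obtain ⟨V, l, hl, hc⟩ := lt_odomAt.1 h1
  have hl2 := legal_init_mono (V' := insert (y + z) V) (Finset.subset_insert _ _) I η l hl
  have hne : y + z ≠ y := by
    intro h'
    have := congrFun h' 0
    rcases hz with rfl | rfl <;> simp [pt] at this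
  obtain ⟨l', h3, h4⟩ := flow_extend _ I η y (y + z) (Finset.mem_insert_self _ _) hne l hl2
  simp only [add_sub_cancel_left] at h4
  have hc' : K < l.count y := by exact_mod_cast hc
  have h5 := nj_mono I y z hc'.le
  refine lt_of_lt_of_le ?_ (le_odomAt (x := y + z) h3)
  have : B < l'.count (y + z) := by omega
  exact_mod_cast this

lemma odomAt_all {I : Stacks 1} (hI : Reg I) (η : Site 1 → ℕ) (y : Site 1)
    (h : odomAt y I η = ⊤) (w : Site 1) : odomAt w I η = ⊤ := by
  have hr : ∀ k : ℕ, odomAt (y + pt k) I η = ⊤ := by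
    intro k
    induction k with
    | zero =>
      have e : y + pt 0 = y := site_ext (by simp [pt])
      simpa [e] using h
    | succ k ih =>
      have := odomAt_step hI η _ (pt 1) (Or.inl rfl) ih
      rw [add_assoc, ← pt_add] at this
      exact_mod_cast this
  have hl : ∀ k : ℕ, odomAt (y + pt (-k)) I η = ⊤ := by
    intro k
    induction k with
    | zero =>
      have e : y + pt 0 = y := site_ext (by simp [pt])
      simpa [e] using h
    | succ k ih =>
      have := odomAt_step hI η _ (pt (-1)) (Or.inr rfl) ih
      rw [add_assoc, ← pt_add] at this
      convert this using 3
      push_cast; ring_nf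
  rcases le_total (y 0) (w 0) with h1 | h1
  · have := hr (w 0 - y 0).toNat
    convert this
    apply site_ext
    simp [pt]; omega
  · have := hl (y 0 - w 0).toNat
    convert this
    apply site_ext
    simp [pt]; omega

end
end ARW

namespace ARW
noncomputable section
open scoped Classical
set_option linter.unusedSimpArgs false
set_option linter.unnecessarySeqFocus false

/-- modes of the exploration chain. -/
inductive Mode : Type
  | m0 : Mode
  | mA : Mode
  | mB : Site 1 → Mode
  | mC : Mode
  | mT : Mode

/-- states of the chain. -/
abbrev CS := Mode × State 1

/-- distance in dimension one. -/
def ds (x w : Site 1) : ℕ := (w 0 - x 0).natAbs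

/-- weak legality with respect to `x`. -/
def wk (V : Finset (Site 1)) (x : Site 1) (s : State 1) (y : Site 1) : Prop :=
  y ∈ V ∧ 1 ≤ numActive (s.1 y) ∧ (y = x → 2 ≤ numActive (s.1 y))

/-- an arbitrary active site. -/
def anyAct (V : Finset (Site 1)) (s : State 1) : Option (Site 1) :=
  if h : ∃ y, y ∈ V ∧ 1 ≤ numActive (s.1 y) then some h.choose else none

/-- the site toppled next. -/
def pick (V : Finset (Site 1)) (x : Site 1) (c : CS) : Option (Site 1) :=
  match c.1 with
  | .m0 => anyAct V c.2
  | .mA => if h : ∃ y, wk V x c.2 y then some h.choose else some x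
  | .mB w => some w
  | .mC => anyAct V c.2
  | .mT => none

/-- the mode when the tagged particle enters `w`. -/
def enter (x : Site 1) (r : ℕ) (w : Site 1) (s : State 1) : Mode :=
  if w = x then .mA else if 2 ≤ numActive (s.1 w) ∧ ds x w < r then .mB w else .mC

/-- mode update. -/
def nmode (V : Finset (Site 1)) (x : Site 1) (r : ℕ) (c : CS) (i : Instr 1) (s' : State 1) : Mode :=
  match c.1 with
  | .m0 => if 1 ≤ numActive (s'.1 x) then .mA else .m0
  | .mA => if ∃ y, wk V x c.2 y then .mA else
      match i with
      | none => .mT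
      | some z => enter x r (x + z) s'
  | .mB w =>
      match i with
      | none => .mB w
      | some z => enter x r (w + z) s'
  | .mC => .mC
  | .mT => .mT

/-- one step of the chain with a given instruction. -/
def next (V : Finset (Site 1)) (x : Site 1) (r : ℕ) (c : CS) (i : Instr 1) : CS :=
  match pick V x c with
  | none => c
  | some y => (nmode V x r c i (top V i y c.2), top V i y c.2)

/-- valid states. -/
def Valid (V : Finset (Site 1)) (x : Site 1) (r : ℕ) (c : CS) : Prop :=
  match c.1 with
  | .m0 => c.2.1 x = .active 0 ∧ c.2.2 x = 0
  | .mA => 1 ≤ numActive (c.2.1 x)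
  | .mB w => 2 ≤ numActive (c.2.1 w) ∧ ds x w < r ∧ w ≠ x
  | .mC => True
  | .mT => Stable V c.2.1 ∧ c.2.1 x = .sleeping

/-- offsets of the sites in the punctured ball. -/
def offs (r : ℕ) : Finset ℤ := (Finset.Ioo (-(r : ℤ)) r).erase 0

/-- harmonic weight of the empty sites. -/
def Sf (x : Site 1) (r : ℕ) (σ : Config 1) : ℝ :=
  ∑ k ∈ offs r, if σ (x + pt k) = .active 0 then (1 : ℝ) / (k.natAbs : ℝ) else 0

/-- the potential. -/
def pot (lam : ℝ) (x : Site 1) (r : ℕ) (c : CS) : ℝ :=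
  match c.1 with
  | .m0 => 1 / (lam * r)
  | .mA => 1 / (lam * r)
  | .mB w => 1 / (lam * r) + (ds x w : ℝ) * (1 / r + Sf x r c.2.1)
  | .mC => 1
  | .mT => - (1 / lam) * Sf x r c.2.1

/-- admissible instructions. -/
def Good (i : Instr 1) : Prop := i = none ∨ i = some (pt 1) ∨ i = some (pt (-1))

lemma Sf_nonneg (x : Site 1) (r : ℕ) (σ : Config 1) : 0 ≤ Sf x r σ := by
  unfold Sf
  refine Finset.sum_nonneg fun k _ => ?_
  split_ifs <;> positivity

lemma anyAct_some {V : Finset (Site 1)} {s : State 1} {y : Site 1} (h : anyAct V s = some y) :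
    y ∈ V ∧ 1 ≤ numActive (s.1 y) := by
  unfold anyAct at h
  split_ifs at h with h1
  have := h1.choose_spec
  rw [Option.some.inj h] at this
  exact this

lemma anyAct_none {V : Finset (Site 1)} {s : State 1} (h : anyAct V s = none) :
    Stable V s.1 := by
  unfold anyAct at h
  split_ifs at h with h1
  push Not at h1
  intro y hy
  have := h1 y hy
  omega

lemma act_zero_ne (V : Finset (Site 1)) (i : Instr 1) (u y : Site 1) (a : SiteState) (h : y ≠ u)
    (h0 : act V i u y a = .active 0) : a = .active 0 := by
  unfold act at h0
  rw [if_neg h] at h0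
  split_ifs at h0
  · rcases a with n | _ <;> simp [addParticle] at h0
  · exact h0

lemma Sf_top (V : Finset (Site 1)) (i : Instr 1) (x u : Site 1) (r : ℕ) (s : State 1)
    (hu : u = x ∨ 2 ≤ numActive (s.1 u)) : Sf x r (top V i u s).1 ≤ Sf x r s.1 := by
  unfold Sf
  refine Finset.sum_le_sum fun k hk => ?_
  by_cases h1 : (top V i u s).1 (x + pt k) = .active 0
  · have h2 : s.1 (x + pt k) = .active 0 := by
      by_cases hy : x + pt k = u
      · exfalso
        rcases hu with rfl | hu
        · have := congrFun hy 0
          simp [pt] at this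
          simp [offs, this] at hk
        · have := numActive_act_self V i u (s.1 u) 0 (by omega)
          rw [hy] at h1
          simp only [top] at h1
          rw [h1] at this
          simp [numActive] at this
      · exact act_zero_ne V i u _ _ hy h1
    rw [if_pos h1, if_pos h2]
  · rw [if_neg h1]
    split_ifs <;> positivity

lemma Sf_single (x w : Site 1) (r : ℕ) (σ : Config 1) (hw : w ≠ x) (h : ds x w < r)
    (h0 : σ w = .active 0) : 1 ≤ (ds x w : ℝ) * Sf x r σ := by
  have hk : w 0 - x 0 ∈ offs r := by
    simp only [offs, Finset.mem_erase, Finset.mem_Ioo]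
    unfold ds at h
    refine ⟨fun h' => hw (site_ext (by omega)), by omega, by omega⟩
  have hxw : x + pt (w 0 - x 0) = w := site_ext (by simp [pt])
  have h1 : (1 : ℝ) / (ds x w : ℝ) ≤ Sf x r σ := by
    unfold Sf
    have := Finset.single_le_sum (f := fun k : ℤ => if σ (x + pt k) = .active 0 then
      (1 : ℝ) / (k.natAbs : ℝ) else 0) (s := offs r) (fun k _ => by
        split_ifs <;> positivity) hk
    simp only [hxw, h0, if_true] at this
    exact this
  have hpos : (0 : ℝ) < ds x w := by
    have : 0 < ds x w := by
      unfold ds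
      have : w 0 ≠ x 0 := fun h' => hw (site_ext h')
      omega
    exact_mod_cast this
  rw [div_le_iff₀ hpos] at h1
  linarith

lemma top_hit (V : Finset (Site 1)) (z u : Site 1) (hz : u + z ≠ u) (hV : u + z ∈ V) (s : State 1) :
    (top V (some z) u s).1 (u + z) = addParticle (s.1 (u + z)) := by
  simp [top, act, hit, hV, hz]

lemma pot_enter {lam : ℝ} (hlam : 0 < lam) {V : Finset (Site 1)} {x : Site 1} {r : ℕ} (hr : 1 ≤ r)
    (hV : ∀ w, ds x w < r → w ∈ V) (s : State 1) (u z : Site 1) (hz : u + z ≠ u)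
    (hu : u = x ∨ 2 ≤ numActive (s.1 u)) (hd : ds x (u + z) ≤ r) :
    pot lam x r (enter x r (u + z) (top V (some z) u s), top V (some z) u s) ≤
      1 / (lam * r) + (ds x (u + z) : ℝ) * (1 / r + Sf x r s.1) := by
  have hα : 0 ≤ 1 / (lam * r) := by positivity
  have hS := Sf_nonneg x r s.1
  have hS' := Sf_top V (some z) x u r s hu
  have hr' : (0 : ℝ) < r := by exact_mod_cast hr
  unfold enter
  by_cases h1 : u + z = x
  · rw [if_pos h1]
    simp only [pot]
    have : 0 ≤ (ds x (u + z) : ℝ) * (1 / r + Sf x r s.1) := by positivity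
    linarith
  · rw [if_neg h1]
    by_cases h2 : ds x (u + z) < r
    · have ht := top_hit V z u hz (hV _ h2) s
      by_cases h3 : 2 ≤ numActive ((top V (some z) u s).1 (u + z))
      · rw [if_pos ⟨h3, h2⟩]
        simp only [pot]
        gcongr
      · rw [if_neg (by tauto)]
        simp only [pot]
        have h0 : s.1 (u + z) = .active 0 := by
          rw [ht] at h3
          rcases h : s.1 (u + z) with n | _
          · rw [h] at h3; simp [addParticle, numActive] at h3; simp [h3]
          · rw [h] at h3; simp [addParticle, numActive] at h3
        have := Sf_single x (u + z) r s.1 h1 h2 h0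
        have h5 : 0 ≤ (ds x (u + z) : ℝ) * (1 / r) := by positivity
        nlinarith
    · rw [if_neg (by tauto)]
      simp only [pot]
      have h6 : ds x (u + z) = r := by omega
      rw [h6, mul_add, mul_one_div_cancel hr'.ne']
      have : 0 ≤ (r : ℝ) * Sf x r s.1 := by positivity
      linarith

lemma numActive_ne (V : Finset (Site 1)) (i : Instr 1) (u y : Site 1) (a : SiteState) (h : y ≠ u)
    (k : ℕ) (h0 : k ≤ numActive a) : k ≤ numActive (act V i u y a) := by
  unfold act
  rw [if_neg h]
  split_ifs
  · exact h0.trans (numActive_add _)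
  · exact h0

lemma pm_ne (u z : Site 1) (hz : z = pt 1 ∨ z = pt (-1)) : u + z ≠ u := by
  intro h'
  have := congrFun h' 0
  rcases hz with rfl | rfl <;> simp [pt] at this

lemma valid_enter {V : Finset (Site 1)} {x : Site 1} {r : ℕ} (hr : 1 ≤ r)
    (hV : ∀ w, ds x w < r → w ∈ V) (s : State 1) (u z : Site 1) (hz : u + z ≠ u) :
    Valid V x r (enter x r (u + z) (top V (some z) u s), top V (some z) u s) := by
  unfold enter
  by_cases h1 : u + z = x
  · rw [if_pos h1]
    simp only [Valid]
    have := top_hit V z u hz (hV _ (by rw [h1]; simp [ds]; omega)) s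
    rw [h1] at this
    rw [this]
    rcases s.1 x with n | _ <;> simp [addParticle, numActive]
  · rw [if_neg h1]
    split_ifs with h2
    · exact ⟨h2.1, h2.2, h1⟩
    · trivial

lemma pick_legal {V : Finset (Site 1)} {x : Site 1} {r : ℕ} (hr : 1 ≤ r)
    (hV : ∀ w, ds x w < r → w ∈ V) (c : CS) (hc : Valid V x r c) (y : Site 1)
    (h : pick V x c = some y) : y ∈ V ∧ 1 ≤ numActive (c.2.1 y) := by
  have hx : x ∈ V := hV x (by simp [ds]; omega)
  rcases c with ⟨m, s⟩
  rcases m with _ | _ | w | _ | _ <;> simp only [pick, Valid] at h hc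
  · exact anyAct_some h
  · split_ifs at h with h1
    · have := h1.choose_spec
      rw [Option.some.inj h] at this
      exact ⟨this.1, this.2.1⟩
    · rw [← Option.some.inj h]; exact ⟨hx, hc⟩
  · rw [← Option.some.inj h]; exact ⟨hV _ hc.2.1, le_trans (by omega) hc.1⟩
  · exact anyAct_some h
  · simp at h

lemma valid_next {V : Finset (Site 1)} {x : Site 1} {r : ℕ} (hr : 1 ≤ r)
    (hV : ∀ w, ds x w < r → w ∈ V) (c : CS) (hc : Valid V x r c) (i : Instr 1) (hi : Good i) :
    Valid V x r (next V x r c i) := by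
  have hx : x ∈ V := hV x (by simp [ds]; omega)
  unfold next
  rcases hp : pick V x c with _ | y
  · exact hc
  · have hl := pick_legal hr hV c hc y hp
    have hgood : ∀ z, i = some z → z = pt 1 ∨ z = pt (-1) := by
      rintro z rfl
      rcases hi with h | h | h
      · simp at h
      · left; exact Option.some.inj h
      · right; exact Option.some.inj h
    rcases c with ⟨m, s⟩
    rcases m with _ | _ | w | _ | _
    · simp only [Valid] at hc
      have hyx : x ≠ y := by
        rintro rfl; rw [hc.1] at hl; simp [numActive] at hl
      simp only [nmode]
      split_ifs with h1
      · exact h1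
      · simp only [Valid]
        refine ⟨?_, by simp [top, hyx, hc.2]⟩
        simp only [top, act, if_neg hyx, hc.1] at h1 ⊢
        split_ifs at h1 ⊢ with h2
        · simp [addParticle, numActive] at h1
        · rfl
    · simp only [Valid] at hc
      simp only [nmode]
      simp only [pick] at hp
      split_ifs at hp with h1
      · rw [if_pos h1]
        simp only [Valid, top]
        have hs := h1.choose_spec
        rw [Option.some.inj hp] at hs
        by_cases hy : x = y
        · subst hy
          exact numActive_act_self V i x _ 0 (hs.2.2 rfl)
        · exact numActive_ne V i y x _ hy 1 hc
      · have hyx := Option.some.inj hp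
        subst hyx
        rw [if_neg h1]
        have h2 : ∀ y ∈ V, y ≠ x → numActive (s.1 y) = 0 := by
          intro y hy hyx
          by_contra h0
          exact h1 ⟨y, hy, by omega, fun h => absurd h hyx⟩
        have h3 : numActive (s.1 x) = 1 := by
          by_contra h0
          have hc' : 1 ≤ numActive (s.1 x) := hc
          exact h1 ⟨x, hx, hc, fun _ => (by omega : 2 ≤ numActive (s.1 x))⟩
        rcases i with _ | z
        · simp only [Valid]
          have e : (top V none x s).1 x = .sleeping := by
            simp [top, act, hit, own, h3]
          refine ⟨fun y hy => ?_, e⟩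
          by_cases hyx : y = x
          · subst hyx; rw [e]; rfl
          · have : (top V none x s).1 y = s.1 y := by simp [top, act, hit, hyx]
            rw [this]; exact h2 y hy hyx
        · exact valid_enter hr hV s x z (pm_ne _ _ (hgood z rfl))
    · simp only [pick] at hp
      have hyw := Option.some.inj hp
      subst hyw
      simp only [nmode]
      rcases i with _ | z
      · simp only [Valid] at hc ⊢
        refine ⟨?_, hc.2⟩
        have : (top V none w s).1 w = s.1 w := by
          have h1 : numActive (s.1 w) ≠ 1 := by have := hc.1; omega
          simp [top, act, hit, own, h1]
        rw [this]; exact hc.1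
      · exact valid_enter hr hV s w z (pm_ne _ _ (hgood z rfl))
    · trivial
    · simp [pick] at hp

lemma Sf_top_none (V : Finset (Site 1)) (x u : Site 1) (r : ℕ) (s : State 1)
    (hu : u = x ∨ 2 ≤ numActive (s.1 u)) : Sf x r (top V none u s).1 = Sf x r s.1 := by
  unfold Sf
  refine Finset.sum_congr rfl fun k hk => ?_
  have : (top V none u s).1 (x + pt k) = s.1 (x + pt k) := by
    by_cases hy : x + pt k = u
    · rcases hu with rfl | hu
      · have := congrFun hy 0
        simp [pt] at this
        simp [offs, this] at hk
      · rw [hy]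
        have h1 : numActive (s.1 u) ≠ 1 := by omega
        simp [top, act, hit, own, h1]
    · simp [top, act, hit, hy]
  rw [this]

lemma ds_pm (x u : Site 1) (hu : u ≠ x) :
    (ds x (u + pt 1) : ℝ) + ds x (u + pt (-1)) = 2 * ds x u := by
  have : ds x (u + pt 1) + ds x (u + pt (-1)) = 2 * ds x u := by
    have : u 0 ≠ x 0 := fun h' => hu (site_ext h')
    simp only [ds, Pi.add_apply, pt]
    omega
  exact_mod_cast this

lemma pot_step {lam : ℝ} (hlam : 0 < lam) {V : Finset (Site 1)} {x : Site 1} {r : ℕ} (hr : 1 ≤ r)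
    (hV : ∀ w, ds x w < r → w ∈ V) (c : CS) (hc : Valid V x r c) :
    lamS lam * pot lam x r (next V x r c none) + lamJ lam / 2 *
      (pot lam x r (next V x r c (some (pt 1))) + pot lam x r (next V x r c (some (pt (-1)))))
      ≤ pot lam x r c := by
  have hS : 0 ≤ lamS lam := by unfold lamS; positivity
  have hJ : 0 ≤ lamJ lam := by unfold lamJ; positivity
  have hSJ : lamS lam + lamJ lam = 1 := by unfold lamS lamJ; field_simp; ring
  have hr' : (0 : ℝ) < r := by exact_mod_cast hr
  have triv : (∀ i, pot lam x r (next V x r c i) = pot lam x r c) →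
      lamS lam * pot lam x r (next V x r c none) + lamJ lam / 2 *
      (pot lam x r (next V x r c (some (pt 1))) + pot lam x r (next V x r c (some (pt (-1)))))
      ≤ pot lam x r c := by
    intro h
    rw [h, h, h]
    have : lamS lam = 1 - lamJ lam := by linarith
    rw [this]; apply le_of_eq; ring
  rcases hp : pick V x c with _ | y
  · exact triv (fun i => by simp [next, hp])
  · have hn : ∀ i, next V x r c i = (nmode V x r c i (top V i y c.2), top V i y c.2) :=
      fun i => by simp [next, hp]
    rcases c with ⟨m, s⟩
    rcases m with _ | _ | w | _ | _
    · refine triv fun i => ?_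
      rw [hn]
      simp only [nmode]
      split_ifs <;> rfl
    · simp only [Valid] at hc
      simp only [pick] at hp
      split_ifs at hp with h1
      · refine triv fun i => ?_
        rw [hn]
        simp only [nmode, if_pos h1]; rfl
      · have hyx := Option.some.inj hp
        subst hyx
        have e1 := pot_enter hlam hr hV s x (pt 1) (pm_ne _ _ (Or.inl rfl)) (Or.inl rfl)
          (by simp [ds, pt]; omega)
        have e2 := pot_enter hlam hr hV s x (pt (-1)) (pm_ne _ _ (Or.inr rfl)) (Or.inl rfl)
          (by simp [ds, pt]; omega)
        have d1 : ds x (x + pt 1) = 1 := by simp [ds, pt]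
        have d2 : ds x (x + pt (-1)) = 1 := by simp [ds, pt]
        rw [d1] at e1
        rw [d2] at e2
        simp only [hn, nmode, if_neg h1]
        have e0 : pot lam x r (Mode.mT, top V none x s) = - (1 / lam) * Sf x r s.1 := by
          simp only [pot]
          rw [Sf_top_none V x x r s (Or.inl rfl)]
        rw [e0]
        have e3 : pot lam x r (Mode.mA, s) = 1 / (lam * r) := rfl
        rw [e3]
        calc _ ≤ lamS lam * (-(1 / lam) * Sf x r s.1) + lamJ lam / 2 *
              ((1 / (lam * r) + ((1 : ℕ) : ℝ) * (1 / r + Sf x r s.1)) +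
               (1 / (lam * r) + ((1 : ℕ) : ℝ) * (1 / r + Sf x r s.1))) := by gcongr
          _ = 1 / (lam * r) := by
            unfold lamS lamJ
            have : 1 + lam ≠ 0 := by positivity
            field_simp
            push_cast
            ring
    · simp only [Valid] at hc
      simp only [pick] at hp
      have hyw := Option.some.inj hp
      subst hyw
      have hd := hc.2.1
      have e1 := pot_enter hlam hr hV s w (pt 1) (pm_ne _ _ (Or.inl rfl)) (Or.inr hc.1)
        (by simp only [ds, Pi.add_apply, pt] at hd ⊢; omega)
      have e2 := pot_enter hlam hr hV s w (pt (-1)) (pm_ne _ _ (Or.inr rfl)) (Or.inr hc.1)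
        (by simp only [ds, Pi.add_apply, pt] at hd ⊢; omega)
      simp only [hn, nmode]
      have e0 : pot lam x r (Mode.mB w, top V none w s) = pot lam x r (Mode.mB w, s) := by
        simp only [pot]
        rw [Sf_top_none V x w r s (Or.inr hc.1)]
      rw [e0]
      have e3 : pot lam x r (Mode.mB w, s) =
        1 / (lam * r) + (ds x w : ℝ) * (1 / r + Sf x r s.1) := rfl
      have e4 := ds_pm x w hc.2.2
      have e5 : pot lam x r (enter x r (w + pt 1) (top V (some (pt 1)) w s), top V (some (pt 1)) w s)
        + pot lam x r (enter x r (w + pt (-1)) (top V (some (pt (-1))) w s),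
          top V (some (pt (-1))) w s) ≤ 2 * pot lam x r (Mode.mB w, s) := by
        rw [e3]
        refine (add_le_add e1 e2).trans (le_of_eq ?_)
        have : (ds x (w + pt 1) : ℝ) = 2 * ds x w - ds x (w + pt (-1)) := by linarith
        rw [this]; ring
      calc _ ≤ lamS lam * pot lam x r (Mode.mB w, s) + lamJ lam / 2 *
            (2 * pot lam x r (Mode.mB w, s)) := by gcongr
        _ = (lamS lam + lamJ lam) * pot lam x r (Mode.mB w, s) := by ring
        _ = pot lam x r (Mode.mB w, s) := by rw [hSJ, one_mul]
    · refine triv fun i => ?_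
      rw [hn]; rfl
    · simp [pick] at hp

/-- algebraic expectation after `t` steps. -/
def Ex (lam : ℝ) (V : Finset (Site 1)) (x : Site 1) (r : ℕ) : ℕ → (CS → ℝ) → CS → ℝ
  | 0, f, c => f c
  | t + 1, f, c => lamS lam * Ex lam V x r t f (next V x r c none) + lamJ lam / 2 *
      (Ex lam V x r t f (next V x r c (some (pt 1))) +
       Ex lam V x r t f (next V x r c (some (pt (-1)))))

lemma Ex_mono {lam : ℝ} (hlam : 0 < lam) (V : Finset (Site 1)) (x : Site 1) (r : ℕ) {f g : CS → ℝ}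
    (h : ∀ c, f c ≤ g c) (t : ℕ) : ∀ c, Ex lam V x r t f c ≤ Ex lam V x r t g c := by
  have hS : 0 ≤ lamS lam := by unfold lamS; positivity
  have hJ : 0 ≤ lamJ lam := by unfold lamJ; positivity
  induction t with
  | zero => exact h
  | succ t ih =>
    intro c
    simp only [Ex]
    have h1 := ih (next V x r c none)
    have h2 := ih (next V x r c (some (pt 1)))
    have h3 := ih (next V x r c (some (pt (-1))))
    gcongr

lemma Ex_add (lam : ℝ) (V : Finset (Site 1)) (x : Site 1) (r : ℕ) (f g : CS → ℝ)
    (t : ℕ) : ∀ c, Ex lam V x r t (fun c => f c + g c) c = Ex lam V x r t f c + Ex lam V x r t g c := by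
  induction t with
  | zero => intro c; rfl
  | succ t ih =>
    intro c
    simp only [Ex, ih]
    ring

lemma Ex_smul (lam : ℝ) (V : Finset (Site 1)) (x : Site 1) (r : ℕ) (f : CS → ℝ) (a : ℝ)
    (t : ℕ) : ∀ c, Ex lam V x r t (fun c => a * f c) c = a * Ex lam V x r t f c := by
  induction t with
  | zero => intro c; rfl
  | succ t ih =>
    intro c
    simp only [Ex, ih]
    ring

lemma Ex_zero (lam : ℝ) (V : Finset (Site 1)) (x : Site 1) (r : ℕ)
    (t : ℕ) : ∀ c, Ex lam V x r t (fun _ => 0) c = 0 := by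
  induction t with
  | zero => intro c; rfl
  | succ t ih =>
    intro c
    simp only [Ex, ih]
    ring

lemma Ex_sum {ι : Type*} (lam : ℝ) (V : Finset (Site 1)) (x : Site 1) (r : ℕ) (F : Finset ι)
    (f : ι → CS → ℝ) (t : ℕ) (c : CS) :
    Ex lam V x r t (fun c => ∑ k ∈ F, f k c) c = ∑ k ∈ F, Ex lam V x r t (f k) c := by
  induction F using Finset.induction_on with
  | empty => simp [Ex_zero]
  | insert a F ha ih =>
    simp only [Finset.sum_insert ha, Ex_add, ih]

lemma Ex_pot {lam : ℝ} (hlam : 0 < lam) {V : Finset (Site 1)} {x : Site 1} {r : ℕ} (hr : 1 ≤ r)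
    (hV : ∀ w, ds x w < r → w ∈ V) (t : ℕ) : ∀ c, Valid V x r c →
      Ex lam V x r t (pot lam x r) c ≤ pot lam x r c := by
  have hS : 0 ≤ lamS lam := by unfold lamS; positivity
  have hJ : 0 ≤ lamJ lam := by unfold lamJ; positivity
  induction t with
  | zero => intro c _; exact le_rfl
  | succ t ih =>
    intro c hc
    refine le_trans ?_ (pot_step hlam hr hV c hc)
    simp only [Ex]
    have h1 := ih _ (valid_next hr hV c hc none (Or.inl rfl))
    have h2 := ih _ (valid_next hr hV c hc _ (Or.inr (Or.inl rfl)))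
    have h3 := ih _ (valid_next hr hV c hc _ (Or.inr (Or.inr rfl)))
    gcongr

/-- the indicator of mode C. -/
def indC (c : CS) : ℝ := if c.1 = .mC then 1 else 0

/-- the indicator of mode T with `y` empty. -/
def indT (y : Site 1) (c : CS) : ℝ := if c.1 = .mT ∧ c.2.1 y = .active 0 then 1 else 0

lemma indC_le {lam : ℝ} (hlam : 0 < lam) (x : Site 1) (r : ℕ) (c : CS) :
    indC c ≤ pot lam x r c + ∑ k ∈ offs r, (1 / lam * (1 / (k.natAbs : ℝ))) * indT (x + pt k) c := by
  have hα : 0 ≤ 1 / (lam * r) := by positivity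
  have hS := Sf_nonneg x r c.2.1
  have h0 : ∀ k : ℤ, 0 ≤ (1 / lam * (1 / (k.natAbs : ℝ))) * indT (x + pt k) c := by
    intro k
    unfold indT
    split_ifs <;> positivity
  have h1 := Finset.sum_nonneg (s := offs r) (fun k _ => h0 k)
  rcases c with ⟨m, s⟩
  rcases m with _ | _ | w | _ | _
  · simp only [indC, pot, reduceCtorEq, if_false]; linarith
  · simp only [indC, pot, reduceCtorEq, if_false]; linarith
  · simp only [indC, pot, reduceCtorEq, if_false]
    have : 0 ≤ (ds x w : ℝ) * (1 / r + Sf x r s.1) := by simp only at hS; positivity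
    linarith
  · simp only [indC, pot, if_true]; linarith
  · simp only [indC, pot, reduceCtorEq, if_false]
    have : ∑ k ∈ offs r, (1 / lam * (1 / (k.natAbs : ℝ))) * indT (x + pt k) (Mode.mT, s)
      = 1 / lam * Sf x r s.1 := by
      unfold Sf
      rw [Finset.mul_sum]
      refine Finset.sum_congr rfl fun k _ => ?_
      simp only [indT, true_and]
      split_ifs <;> simp
    rw [this]
    apply le_of_eq; ring

lemma Ex_indC {lam : ℝ} (hlam : 0 < lam) {V : Finset (Site 1)} {x : Site 1} {r : ℕ} (hr : 1 ≤ r)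
    (hV : ∀ w, ds x w < r → w ∈ V) (t : ℕ) (c : CS) (hc : Valid V x r c)
    (hm : c.1 = .m0 ∨ c.1 = .mA) :
    Ex lam V x r t indC c ≤ 1 / (lam * r) +
      ∑ k ∈ offs r, (1 / lam * (1 / (k.natAbs : ℝ))) * Ex lam V x r t (indT (x + pt k)) c := by
  refine (Ex_mono hlam V x r (indC_le hlam x r) t c).trans ?_
  rw [Ex_add, Ex_sum]
  simp only [Ex_smul]
  have h1 := Ex_pot hlam hr hV t c hc
  have h2 : pot lam x r c = 1 / (lam * r) := by
    rcases c with ⟨m, s⟩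
    rcases hm with h | h <;> (simp only at h; subst h; rfl)
  linarith

end
end ARW

namespace ARW
noncomputable section
open scoped Classical
set_option linter.unusedSimpArgs false
set_option linter.unnecessarySeqFocus false

/-- law of a single instruction. -/
def instrM (lam : ℝ) : Measure (Instr 1) :=
  ENNReal.ofReal (lamS lam) • Measure.dirac none +
  (ENNReal.ofReal (lamJ lam / 2) • Measure.dirac (some (pt 1)) +
   ENNReal.ofReal (lamJ lam / 2) • Measure.dirac (some (pt (-1))))

lemma lam_facts {lam : ℝ} (hlam : 0 < lam) : 0 < lamS lam ∧ 0 < lamJ lam ∧ lamS lam + lamJ lam = 1 := by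
  refine ⟨by unfold lamS; positivity, by unfold lamJ; positivity, ?_⟩
  unfold lamS lamJ; field_simp; ring

instance instrM_prob {lam : ℝ} [hl : Fact (0 < lam)] : IsProbabilityMeasure (instrM lam) := by
  obtain ⟨h1, h2, h3⟩ := lam_facts hl.out
  constructor
  simp only [instrM, Measure.add_apply, Measure.smul_apply, measure_univ, smul_eq_mul, mul_one]
  rw [← ENNReal.ofReal_add (by positivity) (by positivity),
    ← ENNReal.ofReal_add (by positivity) (by positivity)]
  rw [← ENNReal.ofReal_one]; congr 1; linarith

/-- the law of the stacks. -/
def Mu (lam : ℝ) : Measure (Stacks 1) := Measure.infinitePi (fun _ : Site 1 × ℕ => instrM lam)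

instance Mu_prob {lam : ℝ} [Fact (0 < lam)] : IsProbabilityMeasure (Mu lam) := by
  unfold Mu; infer_instance

instance : MeasurableSingletonClass (Instr 1) := ⟨fun _ => trivial⟩
instance : DiscreteMeasurableSpace (Instr 1) := ⟨fun _ => trivial⟩

lemma pt_one_ne_neg : pt 1 ≠ pt (-1) := fun h => by
  have := congrFun h 0; simp [pt] at this

lemma instrM_singleton {lam : ℝ} (hl : 0 < lam) (g : Instr 1) :
    instrM lam {g} = instrWeight (ssrwStep 1) lam g := by
  obtain ⟨h1, h2, h3⟩ := lam_facts hl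
  have h4 := pt_one_ne_neg
  simp only [instrM, Measure.add_apply, Measure.smul_apply, smul_eq_mul,
    Measure.dirac_apply' _ (MeasurableSet.singleton g), Set.indicator_apply, Set.mem_singleton_iff,
    Pi.one_apply]
  rcases g with _ | z
  · simp [instrWeight]
  · simp only [instrWeight, ssrwStep, reduceCtorEq, if_false, Option.some.injEq,
      Finset.univ_unique, Finset.sum_singleton, Fin.default_eq_zero]
    have e : ENNReal.ofReal (lamJ lam / 2) =
        ENNReal.ofReal (lamJ lam) * ENNReal.ofReal (1 / (2 * ((1 : ℕ) : ℝ))) := by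
      rw [← ENNReal.ofReal_mul h2.le]; congr 1; push_cast; ring
    by_cases hz1 : pt 1 = z
    · subst hz1
      rw [if_neg h4.symm]
      simp [e, pt]
    · by_cases hz2 : pt (-1) = z
      · subst hz2
        simp [e, h4, pt]
      · have : (z 0).natAbs ≠ 1 := by
          intro h
          rcases Int.natAbs_eq (z 0) with h' | h'
          · exact hz1 (site_ext (by simp [pt]; omega))
          · exact hz2 (site_ext (by simp [pt]; omega))
        simp [hz1, hz2, this]

lemma stackLaw_unique {lam : ℝ} [hl : Fact (0 < lam)] (ν : Measure (Stacks 1))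
    (h : IsStackLaw 1 (ssrwStep 1) lam ν) : ν = Mu lam := by
  refine (Measure.isProjectiveLimit_infinitePi
    (fun _ : Site 1 × ℕ => instrM lam)).unique ?_ |>.symm
  intro s
  refine Measure.ext_of_singleton fun g => ?_
  have := h.1
  rw [Measure.map_apply (by fun_prop) (MeasurableSet.singleton g), Measure.pi_singleton]
  have e := h.2 s (fun i => if hi : i ∈ s then g ⟨i, hi⟩ else none)
  have e2 : (s.restrict ⁻¹' {g} : Set (Stacks 1)) =
      {I | ∀ i ∈ s, I i = (fun i => if hi : i ∈ s then g ⟨i, hi⟩ else none) i} := by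
    ext I
    simp only [Set.mem_preimage, Set.mem_singleton_iff, Set.mem_ofPred_eq]
    constructor
    · rintro h i hi
      simp only [hi, dif_pos]
      rw [← h]; rfl
    · intro h
      funext ⟨i, hi⟩
      have := h i hi
      simp only [hi, dif_pos] at this
      exact this
  rw [e2, e, ← Finset.prod_attach, Finset.univ_eq_attach]
  refine Finset.prod_congr rfl fun i _ => ?_
  rw [instrM_singleton hl.out]
  simp

lemma stackLaw_eq {lam : ℝ} [hl : Fact (0 < lam)] : stackLaw 1 (ssrwStep 1) lam = Mu lam := by
  have hex : ∃ μ, IsStackLaw 1 (ssrwStep 1) lam μ := by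
    refine ⟨Mu lam, inferInstance, fun F g => ?_⟩
    have : {I : Stacks 1 | ∀ i ∈ F, I i = g i} = Set.pi F (fun i => {g i}) := by
      ext I; simp [Set.mem_pi]
    rw [this, Mu, Measure.infinitePi_pi _ (fun i _ => MeasurableSet.singleton _)]
    exact Finset.prod_congr rfl fun i _ => instrM_singleton hl.out _
  unfold stackLaw
  rw [dif_pos hex]
  exact stackLaw_unique _ hex.choose_spec

lemma lintegral_instrM (lam : ℝ) (f : Instr 1 → ℝ≥0∞) :
    ∫⁻ a, f a ∂(instrM lam) = ENNReal.ofReal (lamS lam) * f none +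
      (ENNReal.ofReal (lamJ lam / 2) * f (some (pt 1)) +
       ENNReal.ofReal (lamJ lam / 2) * f (some (pt (-1)))) := by
  simp [instrM, lintegral_add_measure, lintegral_smul_measure, lintegral_dirac]

/-! resampling one coordinate -/

lemma map_update {ι A : Type*} [DecidableEq ι] [MeasurableSpace A] (m : Measure A) [IsProbabilityMeasure m] (p : ι) :
    Measure.map (fun q : A × (ι → A) => Function.update q.2 p q.1)
      (m.prod (Measure.infinitePi (fun _ : ι => m))) = Measure.infinitePi (fun _ : ι => m) := by
  have hmeas : Measurable (fun q : A × (ι → A) => Function.update q.2 p q.1) := by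
    rw [measurable_pi_iff]
    intro j
    by_cases hj : j = p
    · subst hj; simp only [Function.update_self]; exact measurable_fst
    · simp only [Function.update_of_ne hj]; fun_prop
  refine Measure.eq_infinitePi _ fun s t ht => ?_
  rw [Measure.map_apply hmeas (MeasurableSet.pi s.countable_toSet fun i _ => ht i)]
  have e : (fun q : A × (ι → A) => Function.update q.2 p q.1) ⁻¹' (Set.pi s t) =
      (if p ∈ s then t p else Set.univ) ×ˢ (Set.pi (s.erase p : Finset ι) t) := by
    ext ⟨a, I⟩
    simp only [Set.mem_preimage, Set.mem_pi, Set.mem_prod, Finset.coe_erase, Set.mem_sdiff,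
      Finset.mem_coe, Set.mem_singleton_iff]
    constructor
    · intro h
      refine ⟨?_, fun i hi => ?_⟩
      · split_ifs with hp
        · simpa using h p hp
        · trivial
      · have := h i hi.1
        rwa [Function.update_of_ne hi.2] at this
    · rintro ⟨h1, h2⟩ i hi
      by_cases hip : i = p
      · subst hip; rw [if_pos hi] at h1; simpa using h1
      · rw [Function.update_of_ne hip]; exact h2 i ⟨hi, hip⟩
  rw [e, Measure.prod_prod, Measure.infinitePi_pi _ (fun i _ => ht i)]
  split_ifs with hp
  · exact Finset.mul_prod_erase s (fun i => m (t i)) hp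
  · simp [Finset.erase_eq_of_notMem hp]

lemma resample {ι A : Type*} [DecidableEq ι] [MeasurableSpace A] (m : Measure A) [IsProbabilityMeasure m] (p : ι)
    (S : Set (ι → A)) (hS : MeasurableSet S) :
    Measure.infinitePi (fun _ : ι => m) S =
      ∫⁻ a, Measure.infinitePi (fun _ : ι => m) {I | Function.update I p a ∈ S} ∂m := by
  have hmeas : Measurable (fun q : A × (ι → A) => Function.update q.2 p q.1) := by
    rw [measurable_pi_iff]
    intro j
    by_cases hj : j = p
    · subst hj; simp only [Function.update_self]; exact measurable_fst
    · simp only [Function.update_of_ne hj]; fun_prop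
  conv_lhs => rw [← map_update m p]
  rw [Measure.map_apply hmeas hS, Measure.prod_apply (hmeas hS)]
  rfl

/-! the chain driven by the stacks -/

/-- one step of the chain driven by `I`. -/
def cstep (V : Finset (Site 1)) (x : Site 1) (r : ℕ) (I : Stacks 1) (c : CS) : CS :=
  match pick V x c with
  | none => c
  | some y => next V x r c (I (y, c.2.2 y))

/-- the chain. -/
def chain (V : Finset (Site 1)) (x : Site 1) (r : ℕ) (I : Stacks 1) : ℕ → CS → CS
  | 0, c => c
  | t + 1, c => chain V x r I t (cstep V x r I c)

lemma next_odom {V : Finset (Site 1)} {x : Site 1} {r : ℕ} {c : CS} {y : Site 1}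
    (h : pick V x c = some y) (i : Instr 1) :
    (next V x r c i).2 = top V i y c.2 := by
  simp [next, h]

lemma chain_update (V : Finset (Site 1)) (x : Site 1) (r : ℕ) (I : Stacks 1) (p : Site 1 × ℕ)
    (a : Instr 1) (t : ℕ) : ∀ c : CS, p.2 < c.2.2 p.1 →
      chain V x r (Function.update I p a) t c = chain V x r I t c := by
  induction t with
  | zero => intro c _; rfl
  | succ t ih =>
    intro c hc
    simp only [chain, cstep]
    rcases hp : pick V x c with _ | y
    · exact ih c hc
    · simp only
      have hne : (y, c.2.2 y) ≠ p := by
        rintro rfl; simp at hc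
      rw [Function.update_of_ne hne]
      apply ih
      rw [next_odom hp]
      simp only [top]
      by_cases hy : p.1 = y
      · rw [hy, Function.update_self]; rw [hy] at hc; omega
      · rw [Function.update_of_ne hy]; exact hc

lemma chain_meas (V : Finset (Site 1)) (x : Site 1) (r : ℕ) (A : Set CS) (t : ℕ) :
    ∀ c : CS, MeasurableSet {I : Stacks 1 | chain V x r I t c ∈ A} := by
  induction t with
  | zero => intro c; simp only [chain]; exact MeasurableSet.const _
  | succ t ih =>
    intro c
    simp only [chain, cstep]
    rcases hp : pick V x c with _ | y
    · exact ih c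
    · simp only
      have : {I : Stacks 1 | chain V x r I t (next V x r c (I (y, c.2.2 y))) ∈ A} =
          ⋃ i : Instr 1, ({I | I (y, c.2.2 y) = i} ∩ {I | chain V x r I t (next V x r c i) ∈ A}) := by
        ext I; simp
      rw [this]
      refine MeasurableSet.iUnion fun i => MeasurableSet.inter ?_ (ih _)
      have hm : Measurable (fun I : Stacks 1 => I (y, c.2.2 y)) := measurable_pi_apply _
      exact hm (MeasurableSet.singleton i)

lemma chain_prob {lam : ℝ} [hl : Fact (0 < lam)] (V : Finset (Site 1)) (x : Site 1) (r : ℕ)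
    (A : Set CS) (t : ℕ) : ∀ c : CS, (Mu lam).real {I | chain V x r I t c ∈ A} =
      Ex lam V x r t (fun c => if c ∈ A then 1 else 0) c := by
  obtain ⟨h1, h2, h3⟩ := lam_facts hl.out
  induction t with
  | zero =>
    intro c
    simp only [chain, Ex]
    by_cases hc : c ∈ A
    · simp [hc]
    · simp [hc]
  | succ t ih =>
    intro c
    rcases hp : pick V x c with _ | y
    · have hn : ∀ i, next V x r c i = c := fun i => by simp [next, hp]
      simp only [Ex, hn, chain, cstep, hp, ih c]
      have : lamS lam = 1 - lamJ lam := by linarith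
      rw [this]; ring
    · simp only [Ex, ← ih]
      have hS := chain_meas V x r A (t + 1) c
      rw [measureReal_def, Mu, resample (instrM lam) (y, c.2.2 y) _ hS, lintegral_instrM]
      have e : ∀ a, {I : Stacks 1 | Function.update I (y, c.2.2 y) a ∈
          {I | chain V x r I (t + 1) c ∈ A}} = {I | chain V x r I t (next V x r c a) ∈ A} := by
        intro a
        ext I
        simp only [Set.mem_ofPred_eq, chain, cstep, hp, Function.update_self]
        rw [chain_update]
        rw [next_odom hp]
        simp [top]
      simp only [e]
      rw [← Mu]
      rw [ENNReal.toReal_add (by finiteness) (by finiteness), ENNReal.toReal_add (by finiteness) (by finiteness)]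
      simp only [ENNReal.toReal_mul, ENNReal.toReal_ofReal h1.le,
        ENNReal.toReal_ofReal (by positivity : 0 ≤ lamJ lam / 2), measureReal_def]
      ring

end
end ARW

namespace ARW
noncomputable section
open scoped Classical
set_option linter.unusedSimpArgs false
set_option linter.unnecessarySeqFocus false

lemma ae_good {lam : ℝ} [hl : Fact (0 < lam)] : ∀ᵐ I ∂(Mu lam), ∀ p, Good (I p) := by
  rw [ae_all_iff]
  intro p
  have h : ∀ᵐ a ∂(instrM lam), Good a := by
    rw [ae_iff]
    simp only [instrM, Measure.add_apply, Measure.smul_apply, smul_eq_mul,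
      Measure.dirac_apply, Set.indicator_apply, Set.mem_ofPred_eq, Good]
    simp
  have e := (measurePreserving_eval_infinitePi (fun _ : Site 1 × ℕ => instrM lam) p)
  exact e.quasiMeasurePreserving.ae h

lemma instrM_pos {lam : ℝ} [hl : Fact (0 < lam)] (z : Site 1) (hz : z = pt 1 ∨ z = pt (-1)) :
    instrM lam {some z}ᶜ < 1 := by
  obtain ⟨h1, h2, h3⟩ := lam_facts hl.out
  have : 0 < instrM lam {some z} := by
    rw [instrM_singleton hl.out]
    simp only [instrWeight, ssrwStep]
    apply ENNReal.mul_pos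
    · simp [h2]
    · rcases hz with rfl | rfl <;> simp [pt]
  rw [prob_compl_eq_one_sub (MeasurableSet.singleton _)]
  exact ENNReal.sub_lt_self (by simp) (by simp) this.ne'

lemma ae_inf {lam : ℝ} [hl : Fact (0 < lam)] (y z : Site 1) (hz : z = pt 1 ∨ z = pt (-1)) (K : ℕ) :
    ∀ᵐ I ∂(Mu lam), ∃ k, K ≤ k ∧ I (y, k) = some z := by
  rw [ae_iff]
  have hb : ∀ n : ℕ, Mu lam {I | ¬ ∃ k, K ≤ k ∧ I (y, k) = some z} ≤ (instrM lam {some z}ᶜ) ^ n := by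
    intro n
    have inj : Function.Injective (fun k : ℕ => ((y, K + k) : Site 1 × ℕ)) := by
      intro a b h; simpa using h
    have h1 : {I : Stacks 1 | ¬ ∃ k, K ≤ k ∧ I (y, k) = some z} ⊆
        Set.pi ((Finset.range n).map ⟨_, inj⟩ : Finset (Site 1 × ℕ)) (fun _ => {some z}ᶜ) := by
      intro I hI
      simp only [Set.mem_ofPred_eq] at hI
      push Not at hI
      rintro ⟨a, b⟩ hi
      simp only [Finset.coe_map, Set.mem_image, Function.Embedding.coeFn_mk] at hi
      obtain ⟨k, _, hk⟩ := hi
      rw [← hk]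
      exact hI (K + k) (by omega)
    refine (measure_mono h1).trans ?_
    rw [Mu, Measure.infinitePi_pi _ (fun _ _ => (MeasurableSet.singleton _).compl)]
    simp
  have ht := ENNReal.tendsto_pow_atTop_nhds_zero_of_lt_one (instrM_pos (lam := lam) z hz)
  exact le_antisymm (ge_of_tendsto' ht hb) zero_le

lemma ae_reg {lam : ℝ} [hl : Fact (0 < lam)] : ∀ᵐ I ∂(Mu lam), Reg I := by
  have h1 : ∀ᵐ I ∂(Mu lam), ∀ (y : Site 1) (K : ℕ), ∃ k, K ≤ k ∧ I (y, k) = some (pt 1) := by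
    simp only [ae_all_iff]
    exact fun y K => ae_inf y _ (Or.inl rfl) K
  have h2 : ∀ᵐ I ∂(Mu lam), ∀ (y : Site 1) (K : ℕ), ∃ k, K ≤ k ∧ I (y, k) = some (pt (-1)) := by
    simp only [ae_all_iff]
    exact fun y K => ae_inf y _ (Or.inr rfl) K
  filter_upwards [ae_good (lam := lam), h1, h2] with I a b c
  refine ⟨a, fun y z hz K => ?_⟩
  rcases hz with rfl | rfl
  · exact b y K
  · exact c y K

lemma chain_idle {V : Finset (Site 1)} {x : Site 1} {r : ℕ} {I : Stacks 1} {c : CS}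
    (h : pick V x c = none) (t : ℕ) : chain V x r I t c = c := by
  induction t with
  | zero => rfl
  | succ t ih =>
    simp only [chain, cstep, h]
    exact ih

lemma chain_legal {V : Finset (Site 1)} {x : Site 1} {r : ℕ} (hr : 1 ≤ r)
    (hV : ∀ w, ds x w < r → w ∈ V) {I : Stacks 1} (hI : ∀ p, Good (I p)) (t : ℕ) :
    ∀ c : CS, Valid V x r c → Valid V x r (chain V x r I t c) ∧
      ∃ l, Legal V I c.2 l ∧ (chain V x r I t c).2 = run V I c.2 l ∧
        (l.length = t ∨ pick V x (chain V x r I t c) = none) := by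
  induction t with
  | zero => intro c hc; exact ⟨hc, [], trivial, rfl, Or.inl rfl⟩
  | succ t ih =>
    intro c hc
    rcases hp : pick V x c with _ | y
    · rw [chain_idle hp]
      exact ⟨hc, [], trivial, rfl, Or.inr hp⟩
    · have hn : cstep V x r I c = next V x r c (I (y, c.2.2 y)) := by simp [cstep, hp]
      have h1 := valid_next hr hV c hc _ (hI (y, c.2.2 y))
      have hl := pick_legal hr hV c hc y hp
      obtain ⟨h2, l, h3, h4, h5⟩ := ih _ h1
      simp only [chain, hn]
      have e : (next V x r c (I (y, c.2.2 y))).2 = topple V I y c.2 := by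
        rw [next_odom hp, topple_eq]
      rw [e] at h3 h4
      refine ⟨h2, y :: l, ⟨hl.1, hl.2, h3⟩, h4, ?_⟩
      rcases h5 with h5 | h5
      · left; simp [h5]
      · right; exact h5

lemma chain_succ' (V : Finset (Site 1)) (x : Site 1) (r : ℕ) (I : Stacks 1) (t : ℕ) :
    ∀ c : CS, chain V x r I (t + 1) c = cstep V x r I (chain V x r I t c) := by
  induction t with
  | zero => intro c; rfl
  | succ t ih =>
    intro c
    rw [chain, ih]
    rfl

lemma cstep_mC (V : Finset (Site 1)) (x : Site 1) (r : ℕ) (I : Stacks 1) (c : CS) (h : c.1 = .mC) :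
    (cstep V x r I c).1 = .mC := by
  rcases c with ⟨m, s⟩
  simp only at h
  subst h
  unfold cstep next
  rcases hp : pick V x (Mode.mC, s) with _ | y
  · rfl
  · simp [nmode]

/-- the site `x` is finally empty. -/
def Emp (V : Finset (Site 1)) (η : Site 1 → ℕ) (x : Site 1) (I : Stacks 1) : Prop :=
  ∃ l, Legal V I (initState 1 V η) l ∧ Stable V (run V I (initState 1 V η) l).1 ∧
    (run V I (initState 1 V η) l).1 x = .active 0

/-- the site `x` never topples. -/
def NoTop (V : Finset (Site 1)) (η : Site 1 → ℕ) (x : Site 1) (I : Stacks 1) : Prop :=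
  ∀ l, Legal V I (initState 1 V η) l → l.count x = 0

/-- initial state of the chain. -/
def cinit (V : Finset (Site 1)) (η : Site 1 → ℕ) (x : Site 1) : CS :=
  (if 1 ≤ numActive ((initState 1 V η).1 x) then .mA else .m0, initState 1 V η)

lemma cinit_valid (V : Finset (Site 1)) (η : Site 1 → ℕ) (x : Site 1) (r : ℕ) :
    Valid V x r (cinit V η x) ∧ ((cinit V η x).1 = .m0 ∨ (cinit V η x).1 = .mA) := by
  unfold cinit
  split_ifs with h
  · exact ⟨h, Or.inr rfl⟩
  · refine ⟨⟨?_, rfl⟩, Or.inl rfl⟩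
    simp only [initState, numActive] at h ⊢
    congr 1
    omega

lemma emp_cases {L : ℕ} {x : Site 1} {r : ℕ} (hr : 1 ≤ r)
    (hV : ∀ w, ds x w < r → w ∈ bx L) {I : Stacks 1} (hI : Reg I) (η : Site 1 → ℕ)
    (h : Emp (bx L) η x I) :
    NoTop (bx L) η x I ∨ ∃ t, (chain (bx L) x r I t (cinit (bx L) η x)).1 = .mC := by
  obtain ⟨B, hB⟩ := length_bdd (L := L) hI η
  obtain ⟨l', hl', hs', hx'⟩ := h
  have hI' : ∀ p, Good (I p) := hI.1
  obtain ⟨h1, l, h3, h4, h5⟩ := chain_legal hr hV hI' (B + 1) _ (cinit_valid (bx L) η x r).1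
  have e0 : (cinit (bx L) η x).2 = initState 1 (bx L) η := rfl
  rw [e0] at h3 h4
  have hp : pick (bx L) x (chain (bx L) x r I (B + 1) (cinit (bx L) η x)) = none := by
    rcases h5 with h5 | h5
    · have := hB l h3; omega
    · exact h5
  by_cases hC : (chain (bx L) x r I (B + 1) (cinit (bx L) η x)).1 = .mC
  · exact Or.inr ⟨_, hC⟩
  left
  set c := chain (bx L) x r I (B + 1) (cinit (bx L) η x) with hc
  rcases hcc : c with ⟨m, s⟩
  rw [hcc] at h1 h4 hp hC
  simp only at h4
  subst h4
  rcases m with _ | _ | w | _ | _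
  · simp only [pick] at hp
    have hst := anyAct_none hp
    simp only [Valid] at h1
    intro l2 hl2
    have := (abelian (bx L) I l2 _ l hl2 h3 hst).1 x
    have h6 := h1.2
    rw [run_odom] at h6
    omega
  · simp only [pick] at hp
    split_ifs at hp
  · simp [pick] at hp
  · exact absurd rfl hC
  · simp only [Valid] at h1
    have := (abelian (bx L) I l' _ l hl' h3 h1.1).2 hs'
    rw [this, h1.2] at hx'
    simp at hx'

lemma mT_emp {V : Finset (Site 1)} {x : Site 1} {r : ℕ} (hr : 1 ≤ r)
    (hV : ∀ w, ds x w < r → w ∈ V) {I : Stacks 1} (hI : ∀ p, Good (I p)) (η : Site 1 → ℕ)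
    (y : Site 1) (t : ℕ) (h : (chain V x r I t (cinit V η x)).1 = .mT)
    (hy : (chain V x r I t (cinit V η x)).2.1 y = .active 0) : Emp V η y I := by
  obtain ⟨h1, l, h3, h4, h5⟩ := chain_legal hr hV hI t _ (cinit_valid V η x r).1
  have e0 : (cinit V η x).2 = initState 1 V η := rfl
  rw [e0] at h3 h4
  refine ⟨l, h3, ?_, ?_⟩
  · rw [← h4]
    simp only [Valid, h] at h1
    exact h1.1
  · rw [← h4]; exact hy

lemma emp_bound {lam : ℝ} [hl : Fact (0 < lam)] {L : ℕ} {x : Site 1} {r : ℕ} (hr : 1 ≤ r)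
    (hV : ∀ w, ds x w < r → w ∈ bx L) (η : Site 1 → ℕ) :
    (Mu lam).real {I | Emp (bx L) η x I} ≤ (Mu lam).real {I | NoTop (bx L) η x I} +
      (1 / (lam * r) + ∑ k ∈ offs r, (1 / lam * (1 / (k.natAbs : ℝ))) *
        (Mu lam).real {I | Emp (bx L) η (x + pt k) I}) := by
  set b := (1 / (lam * r) + ∑ k ∈ offs r, (1 / lam * (1 / (k.natAbs : ℝ))) *
        (Mu lam).real {I | Emp (bx L) η (x + pt k) I}) with hb
  have hlam := hl.out
  have hb0 : 0 ≤ b := by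
    have : 0 ≤ ∑ k ∈ offs r, (1 / lam * (1 / (k.natAbs : ℝ))) *
        (Mu lam).real {I | Emp (bx L) η (x + pt k) I} :=
      Finset.sum_nonneg fun k _ => by positivity
    positivity
  let C : ℕ → Set (Stacks 1) := fun t => {I | chain (bx L) x r I t (cinit (bx L) η x) ∈
    {c : CS | c.1 = .mC}}
  have hC : ∀ t, (Mu lam).real (C t) ≤ b := by
    intro t
    have h1 := chain_prob (lam := lam) (bx L) x r {c : CS | c.1 = .mC} t (cinit (bx L) η x)
    have h2 := Ex_indC hlam hr hV t _ (cinit_valid (bx L) η x r).1 (cinit_valid (bx L) η x r).2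
    have h3 : (Mu lam).real (C t) = Ex lam (bx L) x r t indC (cinit (bx L) η x) := h1
    rw [h3]
    refine h2.trans ?_
    rw [hb]
    gcongr with k hk
    have h4 := chain_prob (lam := lam) (bx L) x r
      {c : CS | c.1 = .mT ∧ c.2.1 (x + pt k) = .active 0} t (cinit (bx L) η x)
    have h5 : Ex lam (bx L) x r t (indT (x + pt k)) (cinit (bx L) η x) = (Mu lam).real
      {I | chain (bx L) x r I t (cinit (bx L) η x) ∈
        {c : CS | c.1 = .mT ∧ c.2.1 (x + pt k) = .active 0}} := by
      rw [h4]
      congr 1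
      funext c
      by_cases hcc : c.1 = .mT ∧ c.2.1 (x + pt k) = .active 0 <;> simp [indT, hcc]
    rw [h5]
    simp only [measureReal_def]
    refine ENNReal.toReal_mono (by finiteness) (measure_mono_ae ?_)
    filter_upwards [ae_good (lam := lam)] with I hI hm
    exact mT_emp hr hV hI η _ t hm.1 hm.2
  have hU : Mu lam (⋃ t, C t) ≤ ENNReal.ofReal b := by
    have hmono : Monotone C := by
      refine monotone_nat_of_le_succ fun t I hI => ?_
      have hI' : (chain (bx L) x r I t (cinit (bx L) η x)).1 = .mC := hI
      have : (chain (bx L) x r I (t + 1) (cinit (bx L) η x)).1 = .mC := by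
        rw [chain_succ']; exact cstep_mC _ _ _ _ _ hI'
      exact this
    rw [hmono.measure_iUnion]
    refine iSup_le fun t => ?_
    rw [ENNReal.le_ofReal_iff_toReal_le (by finiteness) hb0]
    exact hC t
  have hU' : (Mu lam).real (⋃ t, C t) ≤ b := by
    rw [measureReal_def]; exact ENNReal.toReal_le_of_le_ofReal hb0 hU
  calc (Mu lam).real {I | Emp (bx L) η x I}
      ≤ (Mu lam).real ({I | NoTop (bx L) η x I} ∪ ⋃ t, C t) := by
        simp only [measureReal_def]
        refine ENNReal.toReal_mono (by finiteness) (measure_mono_ae ?_)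
        filter_upwards [ae_reg (lam := lam)] with I hI hm
        rcases emp_cases hr hV hI η hm with h | ⟨t, h⟩
        · exact Or.inl h
        · exact Or.inr (Set.mem_iUnion.2 ⟨t, h⟩)
    _ ≤ _ := (measureReal_union_le _ _).trans (by gcongr)

end
end ARW

namespace ARW
noncomputable section
open scoped Classical
set_option linter.unusedSimpArgs false
set_option linter.unnecessarySeqFocus false

/-- translation of arrays. -/
def shiftI {A : Type*} (z : Site 1) (I : Site 1 × ℕ → A) : Site 1 × ℕ → A :=
  fun p => I (p.1 + z, p.2)

/-- translation of states. -/
def shS (z : Site 1) (s : State 1) : State 1 := (fun w => s.1 (w + z), fun w => s.2 (w + z))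

/-- translation of finite sets. -/
def shV (z : Site 1) (V : Finset (Site 1)) : Finset (Site 1) := V.image (fun w => w - z)

lemma mem_shV {z w : Site 1} {V : Finset (Site 1)} : w ∈ shV z V ↔ w + z ∈ V := by
  simp only [shV, Finset.mem_image]
  constructor
  · rintro ⟨a, ha, rfl⟩; simpa using ha
  · intro h; exact ⟨w + z, h, by simp⟩

lemma shift_topple (V : Finset (Site 1)) (I : Stacks 1) (x z : Site 1) (s : State 1) :
    topple (shV z V) (shiftI z I) (x - z) (shS z s) = shS z (topple V I x s) := by
  have e1 : shiftI z I (x - z, (shS z s).2 (x - z)) = I (x, s.2 x) := by simp [shiftI, shS]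
  rw [topple_eq, topple_eq, e1]
  have hw : ∀ w, (w = x - z) = (w + z = x) := fun w => by rw [eq_sub_iff_add_eq]
  refine Prod.ext ?_ ?_
  · funext w
    simp only [top, shS, act, hit, mem_shV, hw, sub_sub_eq_add_sub]
    split_ifs <;> rfl
  · funext w
    simp only [top, shS, Function.update_apply, hw, sub_add_cancel]

lemma shift_legal (V : Finset (Site 1)) (I : Stacks 1) (z : Site 1) (l : List (Site 1)) :
    ∀ s : State 1, Legal V I s l →
      Legal (shV z V) (shiftI z I) (shS z s) (l.map (fun w => w - z)) := by
  induction l with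
  | nil => intros; trivial
  | cons x l ih =>
    intro s h
    simp only [List.map_cons]
    refine ⟨by rw [mem_shV]; simpa using h.1, by simpa [shS] using h.2.1, ?_⟩
    rw [shift_topple]
    exact ih _ h.2.2

lemma shift_init (V : Finset (Site 1)) (η : Site 1 → ℕ) (z : Site 1) :
    shS z (initState 1 V η) = initState 1 (shV z V) (shift z η) := by
  simp only [shS, initState, shift, mem_shV]

lemma count_shift (l : List (Site 1)) (x z : Site 1) :
    (l.map (fun w => w - z)).count x = l.count (x + z) := by
  have : x = (fun w => w - z) (x + z) := by simp
  conv_lhs => rw [this]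
  have hinj : Function.Injective (fun w : Site 1 => w - z) := fun a b h => by simpa using h
  exact List.count_map_of_injective l (fun w : Site 1 => w - z) hinj (x + z)

lemma legal_shift (V : Finset (Site 1)) (I : Stacks 1) (η : Site 1 → ℕ) (z : Site 1)
    (l : List (Site 1)) (h : Legal V I (initState 1 V η) l) :
    Legal (shV z V) (shiftI z I) (initState 1 (shV z V) (shift z η)) (l.map (fun w => w - z)) := by
  rw [← shift_init]
  exact shift_legal V I z l _ h

lemma shiftI_neg {A : Type*} (z : Site 1) (I : Site 1 × ℕ → A) : shiftI (-z) (shiftI z I) = I := by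
  funext p; simp [shiftI]

lemma shift_neg (z : Site 1) (η : Site 1 → ℕ) : shift (-z) (shift z η) = η := by
  funext p; simp [shift]

lemma odomAt_shift_le (I : Stacks 1) (η : Site 1 → ℕ) (x z : Site 1) :
    odomAt (x + z) I η ≤ odomAt x (shiftI z I) (shift z η) := by
  refine iSup_le fun V => iSup_le fun l => iSup_le fun h => ?_
  have := le_odomAt (x := x) (legal_shift V I η z l h)
  rwa [count_shift] at this

lemma odomAt_shift (I : Stacks 1) (η : Site 1 → ℕ) (x z : Site 1) :
    odomAt x (shiftI z I) (shift z η) = odomAt (x + z) I η := by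
  refine le_antisymm ?_ (odomAt_shift_le I η x z)
  have := odomAt_shift_le (shiftI z I) (shift z η) (x + z) (-z)
  rwa [shiftI_neg, shift_neg, add_neg_cancel_right] at this

lemma noTop_shift {L M : ℕ} {x : Site 1} (hx : ((x 0).natAbs) + M ≤ L) (I : Stacks 1)
    (η : Site 1 → ℕ) (h : NoTop (bx L) η x I) : NoTop (bx M) (shift x η) 0 (shiftI x I) := by
  intro l hl
  have h1 := legal_shift _ _ _ (-x) l hl
  rw [shiftI_neg, shift_neg] at h1
  have hsub : shV (-x) (bx M) ⊆ bx L := by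
    intro w hw
    rw [mem_shV, mem_bx] at hw
    rw [mem_bx]
    simp at hw
    omega
  have h2 := h _ (legal_init_mono hsub I η _ h1)
  rwa [count_shift, add_neg_cancel] at h2

/-! measurability -/

lemma meas_legal (V : Finset (Site 1)) (P : State 1 → Prop) (l : List (Site 1)) :
    ∀ s : State 1, MeasurableSet {I : Stacks 1 | Legal V I s l ∧ P (run V I s l)} := by
  induction l with
  | nil => intro s; simp only [Legal, run]; exact MeasurableSet.const _
  | cons x l ih =>
    intro s
    have : {I : Stacks 1 | Legal V I s (x :: l) ∧ P (run V I s (x :: l))} =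
        ⋃ i : Instr 1, ({I : Stacks 1 | x ∈ V ∧ 1 ≤ numActive (s.1 x)} ∩ ({I | I (x, s.2 x) = i} ∩
          {I | Legal V I (top V i x s) l ∧ P (run V I (top V i x s) l)})) := by
      ext I
      simp only [Legal, run, topple_eq, Set.mem_ofPred_eq, Set.mem_iUnion, Set.mem_inter_iff]
      constructor
      · rintro ⟨⟨a, b, c⟩, e⟩
        exact ⟨_, ⟨a, b⟩, rfl, c, e⟩
      · rintro ⟨i, ⟨a, b⟩, rfl, c, e⟩
        exact ⟨⟨a, b, c⟩, e⟩
    rw [this]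
    refine MeasurableSet.iUnion fun i => (MeasurableSet.const _).inter (MeasurableSet.inter ?_ (ih _))
    have hm : Measurable (fun I : Stacks 1 => I (x, s.2 x)) := measurable_pi_apply _
    exact hm (MeasurableSet.singleton i)

lemma joint_meas (V : Finset (Site 1)) (Q : State 1 → Stacks 1 → Prop)
    (h : ∀ s, MeasurableSet {I | Q s I}) :
    MeasurableSet {p : (Site 1 → ℕ) × Stacks 1 | Q (initState 1 V p.1) p.2} := by
  let ex : (V → ℕ) → (Site 1 → ℕ) := fun g x => if hx : x ∈ V then g ⟨x, hx⟩ else 0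
  have : {p : (Site 1 → ℕ) × Stacks 1 | Q (initState 1 V p.1) p.2} =
      ⋃ g : V → ℕ, {η : Site 1 → ℕ | ∀ v : V, η v = g v} ×ˢ {I | Q (initState 1 V (ex g)) I} := by
    have key : ∀ (η : Site 1 → ℕ) (g : V → ℕ), (∀ v : V, η v = g v) →
        initState 1 V (ex g) = initState 1 V η := by
      intro η g hg
      unfold initState
      refine Prod.ext ?_ rfl
      funext x
      simp only
      split_ifs with hx
      · simp only [ex, hx, dif_pos]; rw [← hg ⟨x, hx⟩]
      · rfl
    ext ⟨η, I⟩
    simp only [Set.mem_ofPred_eq, Set.mem_iUnion, Set.mem_prod]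
    constructor
    · intro hq
      refine ⟨fun v => η v, fun v => rfl, ?_⟩
      rw [key η _ (fun v => rfl)]; exact hq
    · rintro ⟨g, hg, hq⟩
      rwa [key η g hg] at hq
  rw [this]
  refine MeasurableSet.iUnion fun g => MeasurableSet.prod ?_ (h _)
  have : {η : Site 1 → ℕ | ∀ v : V, η v = g v} = ⋂ v : V, (fun η : Site 1 → ℕ => η v) ⁻¹' {g v} := by
    ext η; simp
  rw [this]
  exact MeasurableSet.iInter fun v => (measurable_pi_apply _) (MeasurableSet.singleton _)

lemma joint_legal (V : Finset (Site 1)) (l : List (Site 1)) :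
    MeasurableSet {p : (Site 1 → ℕ) × Stacks 1 | Legal V p.2 (initState 1 V p.1) l} := by
  refine joint_meas V (fun s I => Legal V I s l) fun s => ?_
  have := meas_legal V (fun _ => True) l s
  simpa using this

lemma joint_emp (V : Finset (Site 1)) (x : Site 1) :
    MeasurableSet {p : (Site 1 → ℕ) × Stacks 1 | Emp V p.1 x p.2} := by
  have : {p : (Site 1 → ℕ) × Stacks 1 | Emp V p.1 x p.2} =
      ⋃ l : List (Site 1), {p | Legal V p.2 (initState 1 V p.1) l ∧
        (Stable V (run V p.2 (initState 1 V p.1) l).1 ∧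
         (run V p.2 (initState 1 V p.1) l).1 x = .active 0)} := by
    ext p; simp [Emp]
  rw [this]
  refine MeasurableSet.iUnion fun l => ?_
  exact joint_meas V (fun s I => Legal V I s l ∧ (Stable V (run V I s l).1 ∧
         (run V I s l).1 x = .active 0))
    (fun s => meas_legal V (fun s' => Stable V s'.1 ∧ s'.1 x = .active 0) l s)

lemma joint_noTop (V : Finset (Site 1)) (x : Site 1) :
    MeasurableSet {p : (Site 1 → ℕ) × Stacks 1 | NoTop V p.1 x p.2} := by
  have : {p : (Site 1 → ℕ) × Stacks 1 | NoTop V p.1 x p.2} =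
      ⋂ l : List (Site 1), ({p | Legal V p.2 (initState 1 V p.1) l}ᶜ ∪ {_p | l.count x = 0}) := by
    ext p
    simp only [NoTop, Set.mem_ofPred_eq, Set.mem_iInter, Set.mem_union, Set.mem_compl_iff]
    exact forall_congr' fun l => by tauto
  rw [this]
  exact MeasurableSet.iInter fun l => (joint_legal V l).compl.union (MeasurableSet.const _)

lemma odomAt_gt_meas (x : Site 1) (k : ℕ) :
    MeasurableSet {p : (Site 1 → ℕ) × Stacks 1 | (k : ℕ∞) < odomAt x p.2 p.1} := by
  have : {p : (Site 1 → ℕ) × Stacks 1 | (k : ℕ∞) < odomAt x p.2 p.1} =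
      ⋃ V : Finset (Site 1), ⋃ l : List (Site 1), ({p | Legal V p.2 (initState 1 V p.1) l} ∩
        {_p | (k : ℕ∞) < (l.count x : ℕ∞)}) := by
    ext p
    simp only [lt_odomAt, Set.mem_ofPred_eq, Set.mem_iUnion, Set.mem_inter_iff]
  rw [this]
  exact MeasurableSet.iUnion fun V => MeasurableSet.iUnion fun l =>
    (joint_legal V l).inter (MeasurableSet.const _)

lemma odomAt_top_eq (x : Site 1) :
    {p : (Site 1 → ℕ) × Stacks 1 | odomAt x p.2 p.1 = ⊤} =
      ⋂ k : ℕ, {p | (k : ℕ∞) < odomAt x p.2 p.1} := by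
  ext p
  simp only [Set.mem_ofPred_eq, Set.mem_iInter]
  rw [ENat.eq_top_iff_forall_gt]

lemma odomAt_top_meas (x : Site 1) :
    MeasurableSet {p : (Site 1 → ℕ) × Stacks 1 | odomAt x p.2 p.1 = ⊤} := by
  rw [odomAt_top_eq]
  exact MeasurableSet.iInter fun k => odomAt_gt_meas x k

/-! invariance of the laws -/

lemma shiftI_meas {A : Type*} [MeasurableSpace A] (z : Site 1) :
    Measurable (shiftI z : (Site 1 × ℕ → A) → _) := by
  rw [measurable_pi_iff]
  intro p
  exact measurable_pi_apply _

lemma shift_meas (z : Site 1) : Measurable (shift z : (Site 1 → ℕ) → _) := by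
  rw [measurable_pi_iff]
  intro p
  exact measurable_pi_apply _

lemma shiftI_map {A : Type*} [MeasurableSpace A] (m : Measure A) [IsProbabilityMeasure m]
    (z : Site 1) : Measure.map (shiftI z) (Measure.infinitePi (fun _ : Site 1 × ℕ => m)) =
      Measure.infinitePi (fun _ : Site 1 × ℕ => m) := by
  refine Measure.eq_infinitePi _ fun s t ht => ?_
  rw [Measure.map_apply (shiftI_meas z) (MeasurableSet.pi s.countable_toSet fun i _ => ht i)]
  have inj : Function.Injective (fun p : Site 1 × ℕ => (p.1 + z, p.2)) := by
    rintro ⟨a, b⟩ ⟨c, e⟩ h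
    simpa using h
  have e : shiftI z ⁻¹' (Set.pi s t) =
      Set.pi (s.map ⟨_, inj⟩ : Finset (Site 1 × ℕ)) (fun p => t (p.1 - z, p.2)) := by
    ext I
    simp only [Set.mem_preimage, Set.mem_pi, Finset.coe_map, Function.Embedding.coeFn_mk]
    constructor
    · rintro h _ ⟨q, hq, rfl⟩
      simpa [shiftI] using h q hq
    · intro h q hq
      simpa [shiftI] using h _ ⟨q, hq, rfl⟩
  rw [e, Measure.infinitePi_pi _ (fun i _ => ht _), Finset.prod_map]
  simp

/-- joint translation. -/
def shP {A : Type*} (z : Site 1) (p : (Site 1 → ℕ) × (Site 1 × ℕ → A)) :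
    (Site 1 → ℕ) × (Site 1 × ℕ → A) := (shift z p.1, shiftI z p.2)

lemma shP_pres {A : Type*} [MeasurableSpace A] (m : Measure A) [IsProbabilityMeasure m]
    (ν : Measure (Site 1 → ℕ)) [IsProbabilityMeasure ν] (hν : ∀ z, Measure.map (shift z) ν = ν)
    (z : Site 1) : MeasurePreserving (shP (A := A) z)
      (ν.prod (Measure.infinitePi (fun _ : Site 1 × ℕ => m)))
      (ν.prod (Measure.infinitePi (fun _ : Site 1 × ℕ => m))) :=
  MeasurePreserving.prod ⟨shift_meas z, hν z⟩ ⟨shiftI_meas z, shiftI_map m z⟩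

end
end ARW

namespace ARW
noncomputable section
open scoped Classical symmDiff
set_option linter.unusedSimpArgs false
set_option linter.unnecessarySeqFocus false

/-- sets depending on the configuration and on finitely many array coordinates. -/
def cylAlg (A : Type*) [MeasurableSpace A] : Set (Set ((Site 1 → ℕ) × (Site 1 × ℕ → A))) :=
  {F | ∃ (K : Finset (Site 1 × ℕ)) (B : Set ((Site 1 → ℕ) × (K → A))), MeasurableSet B ∧
    F = (fun p => (p.1, fun k : K => p.2 k)) ⁻¹' B}

lemma restr_meas {A : Type*} [MeasurableSpace A] (K : Finset (Site 1 × ℕ)) :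
    Measurable (fun p : (Site 1 → ℕ) × (Site 1 × ℕ → A) => (p.1, fun k : K => p.2 k)) := by
  fun_prop

lemma cylAlg_up {A : Type*} [MeasurableSpace A] {K K' : Finset (Site 1 × ℕ)} (h : K ⊆ K')
    {B : Set ((Site 1 → ℕ) × (K → A))} (hB : MeasurableSet B) :
    ∃ B' : Set ((Site 1 → ℕ) × (K' → A)), MeasurableSet B' ∧
      (fun p : (Site 1 → ℕ) × (Site 1 × ℕ → A) => (p.1, fun k : K => p.2 k)) ⁻¹' B =
      (fun p => (p.1, fun k : K' => p.2 k)) ⁻¹' B' := by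
  refine ⟨(fun p => (p.1, fun k : K => p.2 ⟨k, h k.2⟩)) ⁻¹' B, ?_, rfl⟩
  exact (by fun_prop : Measurable (fun p : (Site 1 → ℕ) × (K' → A) =>
    (p.1, fun k : K => p.2 ⟨k, h k.2⟩))) hB

lemma cylAlg_alg (A : Type*) [MeasurableSpace A] : IsSetAlgebra (cylAlg A) where
  empty_mem := ⟨∅, ∅, MeasurableSet.empty, by simp⟩
  compl_mem := by
    rintro s ⟨K, B, hB, rfl⟩
    exact ⟨K, Bᶜ, hB.compl, rfl⟩
  union_mem := by
    rintro s t ⟨K, B, hB, rfl⟩ ⟨K', B', hB', rfl⟩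
    obtain ⟨C, hC, e⟩ := cylAlg_up (A := A) (Finset.subset_union_left (s₁ := K) (s₂ := K')) hB
    obtain ⟨C', hC', e'⟩ := cylAlg_up (A := A) (Finset.subset_union_right (s₁ := K) (s₂ := K')) hB'
    refine ⟨K ∪ K', C ∪ C', hC.union hC', ?_⟩
    rw [e, e']; rfl

lemma cylAlg_gen (A : Type*) [mA : MeasurableSpace A] :
    (inferInstance : MeasurableSpace ((Site 1 → ℕ) × (Site 1 × ℕ → A))) =
      MeasurableSpace.generateFrom (cylAlg A) := by
  refine le_antisymm ?_ ?_
  · refine sup_le ?_ ?_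
    · rintro _ ⟨S, hS, rfl⟩
      refine MeasurableSpace.measurableSet_generateFrom ⟨∅, Prod.fst ⁻¹' S, measurable_fst hS, rfl⟩
    · have : ∀ i : Site 1 × ℕ, Measurable[MeasurableSpace.generateFrom (cylAlg A), mA]
          (fun p : (Site 1 → ℕ) × (Site 1 × ℕ → A) => p.2 i) := by
        intro i T hT
        refine MeasurableSpace.measurableSet_generateFrom
          ⟨{i}, (fun p => p.2 ⟨i, by simp⟩) ⁻¹' T, ?_, rfl⟩
        exact (by fun_prop : Measurable (fun p : (Site 1 → ℕ) × (({i} : Finset (Site 1 × ℕ)) → A) =>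
          p.2 ⟨i, by simp⟩)) hT
      have h2 : Measurable[MeasurableSpace.generateFrom (cylAlg A), MeasurableSpace.pi]
          (fun p : (Site 1 → ℕ) × (Site 1 × ℕ → A) => p.2) := by
        exact (@measurable_pi_iff _ _ _ (MeasurableSpace.generateFrom (cylAlg A)) _ _).2 this
      exact h2.comap_le
  · refine MeasurableSpace.generateFrom_le ?_
    rintro _ ⟨K, B, hB, rfl⟩
    exact restr_meas K hB

lemma exists_disj (K : Finset (Site 1 × ℕ)) :
    ∃ z : Site 1, Disjoint K (K.image (fun p => (p.1 + z, p.2))) := by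
  let N : ℕ := K.sup (fun p => (p.1 0).natAbs)
  refine ⟨pt (2 * N + 1), ?_⟩
  rw [Finset.disjoint_left]
  rintro p hp hq
  rw [Finset.mem_image] at hq
  obtain ⟨q, hq, rfl⟩ := hq
  have h1 := Finset.le_sup (f := fun p : Site 1 × ℕ => (p.1 0).natAbs) hp
  have h2 := Finset.le_sup (f := fun p : Site 1 × ℕ => (p.1 0).natAbs) hq
  have h3 : (pt (2 * N + 1)) 0 = 2 * (N : ℤ) + 1 := rfl
  change ((q.1 0) + (pt (2 * N + 1)) 0).natAbs ≤ N at h1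
  change _ ≤ N at h2
  omega

lemma sec_indep {A : Type*} [MeasurableSpace A] (m : Measure A) [IsProbabilityMeasure m]
    (K : Finset (Site 1 × ℕ)) (z : Site 1) (hd : Disjoint K (K.image (fun p => (p.1 + z, p.2))))
    (C C' : Set (K → A)) (hC : MeasurableSet C) (hC' : MeasurableSet C') :
    Measure.infinitePi (fun _ : Site 1 × ℕ => m)
      ({I | (fun k : K => I k) ∈ C} ∩ {I | (fun k : K => shiftI z I k) ∈ C'}) =
    Measure.infinitePi (fun _ : Site 1 × ℕ => m) {I | (fun k : K => I k) ∈ C} *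
    Measure.infinitePi (fun _ : Site 1 × ℕ => m) {I | (fun k : K => shiftI z I k) ∈ C'} := by
  have hi := ProbabilityTheory.iIndepFun_infinitePi (P := fun _ : Site 1 × ℕ => m)
    (X := fun _ a => a) (fun _ => measurable_id)
  have h2 := ProbabilityTheory.iIndepFun.indepFun_finset K _ hd hi (fun i => measurable_pi_apply i)
  let K' := K.image (fun p => (p.1 + z, p.2))
  let φ : (K' → A) → (K → A) := fun g k =>
    g ⟨(k.1.1 + z, k.1.2), Finset.mem_image_of_mem (fun p : Site 1 × ℕ => (p.1 + z, p.2)) k.2⟩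
  have hφ : Measurable φ := by fun_prop
  exact h2.measure_inter_preimage_eq_mul _ _ hC (hφ hC')

theorem zero_one {A : Type*} [MeasurableSpace A] (m : Measure A) [IsProbabilityMeasure m]
    (ν : Measure (Site 1 → ℕ)) [IsProbabilityMeasure ν] (hν : IsTransErgodic ν)
    (E : Set ((Site 1 → ℕ) × (Site 1 × ℕ → A))) (hE : MeasurableSet E)
    (hinv : ∀ z, shP z ⁻¹' E = E) :
    ν.prod (Measure.infinitePi (fun _ : Site 1 × ℕ => m)) E = 0 ∨
    ν.prod (Measure.infinitePi (fun _ : Site 1 × ℕ => m)) E = 1 := by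
  set π := Measure.infinitePi (fun _ : Site 1 × ℕ => m) with hπ
  let f : (Site 1 → ℕ) → ℝ≥0∞ := fun η => π (Prod.mk η ⁻¹' E)
  have hfm : Measurable f := measurable_measure_prodMk_left hE
  have hf1 : ∀ η, f η ≤ 1 := fun η => prob_le_one
  have hPE : ν.prod π E = ∫⁻ η, f η ∂ν := Measure.prod_apply hE
  have hfinv : ∀ z η, f (shift z η) = f η := by
    intro z η
    change π _ = π _
    have h1 : π (Prod.mk (shift z η) ⁻¹' E) = (Measure.map (shiftI z) π) (Prod.mk (shift z η) ⁻¹' E) := by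
      rw [hπ, shiftI_map]
    rw [h1, Measure.map_apply (shiftI_meas z) (measurable_prodMk_left hE)]
    conv_rhs => rw [← hinv z]
    rfl
  -- the key inequality
  have key : ∀ δ : ℝ, 0 < δ → ν.prod π E ≤ ∫⁻ η, f η * f η ∂ν + 4 * ENNReal.ofReal δ := by
    intro δ hδ
    obtain ⟨F, ⟨K, B, hB, hF⟩, hFE⟩ := (Measure.MeasureDense.of_generateFrom_isSetAlgebra_finite
      (ν.prod π) (cylAlg_alg A) (cylAlg_gen A)).approx E hE (measure_ne_top _ _) δ hδ
    have hFm : MeasurableSet F := by rw [hF]; exact restr_meas K hB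
    obtain ⟨z, hz⟩ := exists_disj K
    have hpres := shP_pres m ν hν.1 z
    set Fz := shP z ⁻¹' F with hFz
    have hFzm : MeasurableSet Fz := hpres.measurable hFm
    have b1 : ν.prod π (E \ F) ≤ ENNReal.ofReal δ :=
      (measure_mono (fun x hx => Or.inl hx)).trans hFE.le
    have b2 : ν.prod π (F \ E) ≤ ENNReal.ofReal δ :=
      (measure_mono (fun x hx => Or.inr hx)).trans hFE.le
    have b3 : ν.prod π (E \ Fz) ≤ ENNReal.ofReal δ := by
      have : E \ Fz = shP z ⁻¹' (E \ F) := by rw [Set.preimage_sdiff, hinv]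
      rw [this, hpres.measure_preimage (hE.diff hFm).nullMeasurableSet]
      exact b1
    have b4 : ν.prod π (Fz \ E) ≤ ENNReal.ofReal δ := by
      have : Fz \ E = shP z ⁻¹' (F \ E) := by rw [Set.preimage_sdiff, hinv]
      rw [this, hpres.measure_preimage (hFm.diff hE).nullMeasurableSet]
      exact b2
    have s1 : ν.prod π E ≤ ν.prod π (F ∩ Fz) + ν.prod π (E \ F) + ν.prod π (E \ Fz) := by
      refine (measure_mono (?_ : E ⊆ ((F ∩ Fz) ∪ (E \ F)) ∪ (E \ Fz))).trans ?_
      · intro x hx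
        by_cases h1 : x ∈ F
        · by_cases h2 : x ∈ Fz
          · exact Or.inl (Or.inl ⟨h1, h2⟩)
          · exact Or.inr ⟨hx, h2⟩
        · exact Or.inl (Or.inr ⟨hx, h1⟩)
      · refine (measure_union_le _ _).trans ?_
        gcongr
        exact measure_union_le _ _
    have s2 : ν.prod π (F ∩ Fz) ≤ ∫⁻ η, (f η * f η + π (Prod.mk η ⁻¹' (F \ E)) +
        π (Prod.mk η ⁻¹' (Fz \ E))) ∂ν := by
      rw [Measure.prod_apply (hFm.inter hFzm)]
      refine lintegral_mono fun η => ?_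
      have e : π (Prod.mk η ⁻¹' (F ∩ Fz)) = π (Prod.mk η ⁻¹' F) * π (Prod.mk η ⁻¹' Fz) := by
        rw [hFz, hF]
        exact sec_indep m K z hz (Prod.mk η ⁻¹' B) (Prod.mk (shift z η) ⁻¹' B)
          (measurable_prodMk_left hB) (measurable_prodMk_left hB)
      have u1 : π (Prod.mk η ⁻¹' F) ≤ f η + π (Prod.mk η ⁻¹' (F \ E)) := by
        refine (measure_mono ?_).trans (measure_union_le _ _)
        intro x hx
        by_cases h : (η, x) ∈ E
        · exact Or.inl h
        · exact Or.inr ⟨hx, h⟩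
      have u2 : π (Prod.mk η ⁻¹' Fz) ≤ f η + π (Prod.mk η ⁻¹' (Fz \ E)) := by
        refine (measure_mono ?_).trans (measure_union_le _ _)
        intro x hx
        by_cases h : (η, x) ∈ E
        · exact Or.inl h
        · exact Or.inr ⟨hx, h⟩
      have u3 : π (Prod.mk η ⁻¹' Fz) ≤ 1 := prob_le_one
      simp only
      rw [e]
      calc π (Prod.mk η ⁻¹' F) * π (Prod.mk η ⁻¹' Fz)
          ≤ (f η + π (Prod.mk η ⁻¹' (F \ E))) * π (Prod.mk η ⁻¹' Fz) := by gcongr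
        _ = f η * π (Prod.mk η ⁻¹' Fz) + π (Prod.mk η ⁻¹' (F \ E)) * π (Prod.mk η ⁻¹' Fz) := by
            rw [add_mul]
        _ ≤ f η * (f η + π (Prod.mk η ⁻¹' (Fz \ E))) + π (Prod.mk η ⁻¹' (F \ E)) * 1 := by gcongr
        _ = f η * f η + f η * π (Prod.mk η ⁻¹' (Fz \ E)) + π (Prod.mk η ⁻¹' (F \ E)) := by
            rw [mul_add, mul_one]
        _ ≤ f η * f η + 1 * π (Prod.mk η ⁻¹' (Fz \ E)) + π (Prod.mk η ⁻¹' (F \ E)) := by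
            gcongr; exact hf1 η
        _ = _ := by rw [one_mul]; ring
    rw [lintegral_add_right _ (measurable_measure_prodMk_left (hFzm.diff hE)),
      lintegral_add_right _ (measurable_measure_prodMk_left (hFm.diff hE)),
      ← Measure.prod_apply (hFzm.diff hE), ← Measure.prod_apply (hFm.diff hE)] at s2
    calc ν.prod π E ≤ ν.prod π (F ∩ Fz) + ν.prod π (E \ F) + ν.prod π (E \ Fz) := s1
      _ ≤ (∫⁻ η, f η * f η ∂ν + ENNReal.ofReal δ + ENNReal.ofReal δ) + ENNReal.ofReal δ +
          ENNReal.ofReal δ := by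
            gcongr
            refine s2.trans ?_
            gcongr
      _ = _ := by ring
  have key2 : ∫⁻ η, f η ∂ν ≤ ∫⁻ η, f η * f η ∂ν := by
    rw [← hPE]
    refine ENNReal.le_of_forall_pos_le_add fun ε hε _ => ?_
    have := key (ε / 4) (by positivity)
    refine this.trans ?_
    gcongr
    have h4 : (4 : ℝ≥0∞) = ENNReal.ofReal 4 := by norm_num
    rw [h4, ← ENNReal.ofReal_mul (by norm_num)]
    rw [show (4 : ℝ) * (ε / 4) = ε by ring]
    simp
  have hle : ∀ η, f η * f η ≤ f η := fun η => by
    calc f η * f η ≤ f η * 1 := by gcongr; exact hf1 η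
      _ = _ := mul_one _
  have hfin : ∫⁻ η, f η * f η ∂ν ≠ ⊤ := by
    refine ne_top_of_le_ne_top one_ne_top ?_
    calc ∫⁻ η, f η * f η ∂ν ≤ ∫⁻ _, 1 ∂ν := lintegral_mono fun η => (hle η).trans (hf1 η)
      _ = 1 := by simp
  have hae : (fun η => f η * f η) =ᵐ[ν] f :=
    ae_eq_of_ae_le_of_lintegral_le (Eventually.of_forall hle) hfin hfm.aemeasurable key2
  have hae2 : f =ᵐ[ν] Set.indicator {η | f η = 1} 1 := by
    filter_upwards [hae] with η h
    by_cases h1 : f η = 1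
    · simp [h1]
    · have : f η = 0 := by
        by_contra h0
        apply h1
        have hne : f η ≠ ⊤ := ne_top_of_le_ne_top one_ne_top (hf1 η)
        have h' : f η * f η = f η * 1 := by simpa using h
        exact (ENNReal.mul_right_inj h0 hne).1 h'
      simp [this]
  have hSm : MeasurableSet {η | f η = 1} := hfm (MeasurableSet.singleton 1)
  rw [hPE, lintegral_congr_ae hae2, lintegral_indicator_one hSm]
  refine hν.2 _ hSm fun z => ?_
  ext η
  simp only [Set.mem_preimage, Set.mem_ofPred_eq, hfinv]

end
end ARW

namespace ARW
noncomputable section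
open scoped Classical
set_option linter.unusedSimpArgs false
set_option linter.unnecessarySeqFocus false
set_option linter.unusedSectionVars false

/-- the joint law of the initial configuration and of the instructions. -/
def PP (lam : ℝ) (ν : Measure (Site 1 → ℕ)) : Measure ((Site 1 → ℕ) × Stacks 1) :=
  ν.prod (Mu lam)

instance PP_prob {lam : ℝ} [Fact (0 < lam)] {ν : Measure (Site 1 → ℕ)} [IsProbabilityMeasure ν] :
    IsProbabilityMeasure (PP lam ν) := by
  unfold PP; infer_instance

/-- probability that `x` ends up empty. -/
def hh (lam : ℝ) (ν : Measure (Site 1 → ℕ)) (L : ℕ) (x : Site 1) : ℝ :=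
  (PP lam ν).real {p | Emp (bx L) p.1 x p.2}

/-- probability that `x` never topples. -/
def qq (lam : ℝ) (ν : Measure (Site 1 → ℕ)) (L : ℕ) (x : Site 1) : ℝ :=
  (PP lam ν).real {p | NoTop (bx L) p.1 x p.2}

section
variable {lam : ℝ} [hl : Fact (0 < lam)] {ν : Measure (Site 1 → ℕ)} [IsProbabilityMeasure ν]

lemma sec_integrable {S : Set ((Site 1 → ℕ) × Stacks 1)} (hS : MeasurableSet S) :
    Integrable (fun η => (Mu lam).real (Prod.mk η ⁻¹' S)) ν := by
  refine Integrable.of_bound (C := 1)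
    (measurable_measure_prodMk_left hS).ennreal_toReal.aestronglyMeasurable ?_
  refine Eventually.of_forall fun η => ?_
  rw [Real.norm_of_nonneg measureReal_nonneg]
  exact measureReal_le_one

lemma sec_integral {S : Set ((Site 1 → ℕ) × Stacks 1)} (hS : MeasurableSet S) :
    (PP lam ν).real S = ∫ η, (Mu lam).real (Prod.mk η ⁻¹' S) ∂ν := by
  unfold Measure.real
  rw [integral_toReal (measurable_measure_prodMk_left hS).aemeasurable
    (Eventually.of_forall fun η => measure_lt_top _ _), PP, Measure.prod_apply hS]

lemma hh_bound {L : ℕ} {x : Site 1} {r : ℕ} (hr : 1 ≤ r) (hV : ∀ w, ds x w < r → w ∈ bx L) :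
    hh lam ν L x ≤ qq lam ν L x + (1 / (lam * r) +
      ∑ k ∈ offs r, (1 / lam * (1 / (k.natAbs : ℝ))) * hh lam ν L (x + pt k)) := by
  unfold hh qq
  have hE : ∀ y, MeasurableSet {p : (Site 1 → ℕ) × Stacks 1 | Emp (bx L) p.1 y p.2} :=
    fun y => joint_emp _ y
  have hN := joint_noTop (bx L) x
  have iE := fun y => sec_integrable (lam := lam) (ν := ν) (hE y)
  have iN := sec_integrable (lam := lam) (ν := ν) hN
  simp only [sec_integral (hE _), sec_integral hN]
  have e : ∫ η, ((Mu lam).real (Prod.mk η ⁻¹' {p | NoTop (bx L) p.1 x p.2}) + (1 / (lam * r) +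
      ∑ k ∈ offs r, (1 / lam * (1 / (k.natAbs : ℝ))) *
        (Mu lam).real (Prod.mk η ⁻¹' {p | Emp (bx L) p.1 (x + pt k) p.2}))) ∂ν =
      ∫ η, (Mu lam).real (Prod.mk η ⁻¹' {p | NoTop (bx L) p.1 x p.2}) ∂ν + (1 / (lam * r) +
      ∑ k ∈ offs r, (1 / lam * (1 / (k.natAbs : ℝ))) *
        ∫ η, (Mu lam).real (Prod.mk η ⁻¹' {p | Emp (bx L) p.1 (x + pt k) p.2}) ∂ν) := by
    have i2 : Integrable (fun η => ∑ k ∈ offs r, (1 / lam * (1 / (k.natAbs : ℝ))) *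
        (Mu lam).real (Prod.mk η ⁻¹' {p | Emp (bx L) p.1 (x + pt k) p.2})) ν :=
      integrable_finsetSum _ fun k _ => (iE _).const_mul _
    have i3 : Integrable (fun η => (1 / (lam * r) + ∑ k ∈ offs r, (1 / lam * (1 / (k.natAbs : ℝ))) *
        (Mu lam).real (Prod.mk η ⁻¹' {p | Emp (bx L) p.1 (x + pt k) p.2}))) ν :=
      (integrable_const _).add i2
    rw [integral_add iN i3, integral_add (integrable_const _) i2,
      integral_finsetSum _ fun k _ => (iE _).const_mul _]
    simp only [integral_const_mul, integral_const, probReal_univ, one_smul]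
  rw [← e]
  refine integral_mono (iE x) ?_ fun η => emp_bound hr hV η
  exact iN.add ((integrable_const _).add (integrable_finsetSum _ fun k _ => (iE _).const_mul _))

lemma PP_pres (hν : IsTransErgodic ν) (z : Site 1) :
    MeasurePreserving (shP z) (PP lam ν) (PP lam ν) :=
  shP_pres (instrM lam) ν hν.1 z

lemma qq_le (hν : IsTransErgodic ν) {L M : ℕ} {x : Site 1} (hx : (x 0).natAbs + M ≤ L) :
    qq lam ν L x ≤ qq lam ν M 0 := by
  unfold qq
  have := (PP_pres (lam := lam) hν x).measureReal_preimage (joint_noTop (bx M) 0).nullMeasurableSet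
  rw [← this]
  refine measureReal_mono ?_ (measure_ne_top _ _)
  intro p hp
  exact noTop_shift hx p.2 p.1 hp

lemma hh_le_one {L : ℕ} {x : Site 1} : hh lam ν L x ≤ 1 := measureReal_le_one

lemma hh_iter (hν : IsTransErgodic ν) {r : ℕ} (hr : 1 ≤ r)
    (hlam : ∑ k ∈ offs r, (1 / lam * (1 / (k.natAbs : ℝ))) ≤ 1 / 2) (L M j : ℕ) :
    ∀ x : Site 1, (x 0).natAbs + M + j * r ≤ L →
      hh lam ν L x ≤ 2 * (qq lam ν M 0 + 1 / (lam * r)) + (1 / 2) ^ j := by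
  have hl0 := hl.out
  have hq0 : 0 ≤ qq lam ν M 0 := measureReal_nonneg
  induction j with
  | zero =>
    intro x _
    have : 0 ≤ 1 / (lam * r) := by positivity
    have := hh_le_one (lam := lam) (ν := ν) (L := L) (x := x)
    simp only [pow_zero]
    linarith
  | succ j ih =>
    intro x hx
    rw [add_mul, one_mul] at hx
    have hb := hh_bound (lam := lam) (ν := ν) (L := L) (x := x) hr (by
      intro w hw
      unfold ds at hw
      rw [mem_bx]
      omega)
    have h1 : qq lam ν L x ≤ qq lam ν M 0 := qq_le hν (by omega)
    set b := 2 * (qq lam ν M 0 + 1 / (lam * r)) + (1 / 2 : ℝ) ^ j with hbdef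
    have hb0 : 0 ≤ b := by positivity
    have h2 : ∑ k ∈ offs r, (1 / lam * (1 / (k.natAbs : ℝ))) * hh lam ν L (x + pt k) ≤
        ∑ k ∈ offs r, (1 / lam * (1 / (k.natAbs : ℝ))) * b := by
      refine Finset.sum_le_sum fun k hk => ?_
      refine mul_le_mul_of_nonneg_left (ih _ ?_) (by positivity)
      simp only [offs, Finset.mem_erase, Finset.mem_Ioo] at hk
      change (x 0 + k).natAbs + M + j * r ≤ L
      omega
    rw [← Finset.sum_mul] at h2
    have h3 : (∑ k ∈ offs r, (1 / lam * (1 / (k.natAbs : ℝ)))) * b ≤ 1 / 2 * b :=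
      mul_le_mul_of_nonneg_right hlam hb0
    rw [pow_succ]
    linarith

lemma mean_site (hν : IsTransErgodic ν) (w : Site 1) :
    ∫⁻ η, (η w : ℝ≥0∞) ∂ν = ∫⁻ η, (η 0 : ℝ≥0∞) ∂ν := by
  conv_rhs => rw [← hν.1 w]
  rw [lintegral_map (by fun_prop) (shift_meas w)]
  simp [shift]

lemma stable_cnt {a : SiteState} (h : numActive a = 0) : cnt a ≤ 1 ∧ (cnt a = 0 → a = .active 0) := by
  cases a with
  | active n => simp only [numActive] at h; subst h; simp [cnt]
  | sleeping => simp [cnt]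

lemma card_nonemp_le {L : ℕ} {I : Stacks 1} (hI : Reg I) (η : Site 1 → ℕ) :
    ∑ x ∈ bx L, (if Emp (bx L) η x I then 0 else 1) ≤ ∑ x ∈ bx L, η x := by
  obtain ⟨l, h1, h2⟩ := exists_stab (L := L) hI η
  rw [← sum_cnt_init (bx L) η]
  refine le_trans ?_ (sum_cnt_run_le _ _ _ _ h1)
  refine Finset.sum_le_sum fun x hx => ?_
  split_ifs with he
  · exact Nat.zero_le _
  · by_contra hc
    exact he ⟨l, h1, h2, (stable_cnt (h2 x hx)).2 (by omega)⟩

lemma ae_reg' : ∀ᵐ p ∂(PP lam ν), Reg p.2 := by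
  have := (Measure.quasiMeasurePreserving_snd (μ := ν) (ν := Mu lam)).ae (ae_reg (lam := lam))
  exact this

lemma sum_hh_le (hν : IsTransErgodic ν) {ρ : ℝ} (hρ : 0 ≤ ρ)
    (hm : ∫⁻ η, (η 0 : ℝ≥0∞) ∂ν = ENNReal.ofReal ρ) (L : ℕ) :
    ∑ x ∈ bx L, (1 - hh lam ν L x) ≤ (2 * L + 1) * ρ := by
  have hE : ∀ y, MeasurableSet {p : (Site 1 → ℕ) × Stacks 1 | Emp (bx L) p.1 y p.2} :=
    fun y => joint_emp _ y
  have h1 : ∀ x, 1 - hh lam ν L x = (PP lam ν).real {p | Emp (bx L) p.1 x p.2}ᶜ := by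
    intro x
    rw [probReal_compl_eq_one_sub (hE x), hh]
  simp only [h1]
  have h2 : ∑ x ∈ bx L, (PP lam ν) {p | Emp (bx L) p.1 x p.2}ᶜ ≤
      ENNReal.ofReal ((2 * L + 1) * ρ) := by
    calc ∑ x ∈ bx L, (PP lam ν) {p | Emp (bx L) p.1 x p.2}ᶜ
        = ∑ x ∈ bx L, ∫⁻ p, Set.indicator {p | Emp (bx L) p.1 x p.2}ᶜ 1 p ∂(PP lam ν) := by
          refine Finset.sum_congr rfl fun x _ => ?_
          rw [lintegral_indicator_one (hE x).compl]
      _ = ∫⁻ p, ∑ x ∈ bx L, Set.indicator {p | Emp (bx L) p.1 x p.2}ᶜ 1 p ∂(PP lam ν) := by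
          rw [lintegral_finsetSum]
          exact fun x _ => measurable_one.indicator (hE x).compl
      _ ≤ ∫⁻ p, ∑ x ∈ bx L, (p.1 x : ℝ≥0∞) ∂(PP lam ν) := by
          refine lintegral_mono_ae ?_
          filter_upwards [ae_reg' (lam := lam) (ν := ν)] with p hp
          have := card_nonemp_le (L := L) hp p.1
          have h' : ((∑ x ∈ bx L, (if Emp (bx L) p.1 x p.2 then 0 else 1) : ℕ) : ℝ≥0∞) ≤
            ((∑ x ∈ bx L, p.1 x : ℕ) : ℝ≥0∞) := by exact_mod_cast this
          push_cast at h'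
          refine le_trans (le_of_eq ?_) h'
          refine Finset.sum_congr rfl fun x _ => ?_
          simp only [Set.indicator_apply, Set.mem_compl_iff, Set.mem_ofPred_eq, Pi.one_apply]
          split_ifs <;> simp_all
      _ = ∑ x ∈ bx L, ∫⁻ p, (p.1 x : ℝ≥0∞) ∂(PP lam ν) := by
          rw [lintegral_finsetSum]
          intro x _
          fun_prop
      _ = ∑ x ∈ bx L, ENNReal.ofReal ρ := by
          refine Finset.sum_congr rfl fun x _ => ?_
          rw [← hm, ← mean_site hν x, PP, lintegral_prod _ (by fun_prop)]
          simp
      _ = _ := by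
          rw [Finset.sum_const, card_bx, nsmul_eq_mul, ENNReal.ofReal_mul (by positivity)]
          congr 1
          rw [show (2 * (L : ℝ) + 1) = ((2 * L + 1 : ℕ) : ℝ) by push_cast; ring,
            ENNReal.ofReal_natCast]
  have h3 := ENNReal.toReal_mono ENNReal.ofReal_ne_top h2
  rw [ENNReal.toReal_ofReal (by positivity), ENNReal.toReal_sum (fun x _ => measure_ne_top _ _)] at h3
  exact h3

lemma rho_ge1 (hν : IsTransErgodic ν) {ρ : ℝ} (hρ : 0 ≤ ρ)
    (hm : ∫⁻ η, (η 0 : ℝ≥0∞) ∂ν = ENNReal.ofReal ρ) {r : ℕ} (hr : 1 ≤ r)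
    (hlam : ∑ k ∈ offs r, (1 / lam * (1 / (k.natAbs : ℝ))) ≤ 1 / 2) (M j : ℕ) :
    1 - (2 * (qq lam ν M 0 + 1 / (lam * r)) + (1 / 2) ^ j) ≤ ρ := by
  set b := 2 * (qq lam ν M 0 + 1 / (lam * r)) + (1 / 2 : ℝ) ^ j with hb
  set D := M + j * r with hD
  have key : ∀ K : ℕ, (2 * K + 1) * (1 - b) ≤ (2 * (K + D : ℕ) + 1) * ρ := by
    intro K
    refine le_trans ?_ (sum_hh_le (lam := lam) hν hρ hm (K + D))
    calc (2 * K + 1) * (1 - b) = ∑ x ∈ bx K, (1 - b) := by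
          rw [Finset.sum_const, card_bx, nsmul_eq_mul]; push_cast; ring
      _ ≤ ∑ x ∈ bx K, (1 - hh lam ν (K + D) x) := by
          refine Finset.sum_le_sum fun x hx => ?_
          rw [mem_bx] at hx
          have := hh_iter (lam := lam) hν hr hlam (K + D) M j x (by omega)
          linarith
      _ ≤ _ := by
          refine Finset.sum_le_sum_of_subset_of_nonneg (bx_mono (by omega)) fun x _ _ => ?_
          have := hh_le_one (lam := lam) (ν := ν) (L := K + D) (x := x)
          linarith
  by_contra hc
  push Not at hc
  obtain ⟨K, hK⟩ := exists_nat_gt (2 * D * ρ / (2 * (1 - b - ρ)))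
  rw [div_lt_iff₀ (by linarith)] at hK
  have := key K
  push_cast at this
  nlinarith

lemma qq_tendsto (h : ∀ᵐ p ∂(PP lam ν), odomAt 0 p.2 p.1 = ⊤) :
    Tendsto (fun M => qq lam ν M 0) atTop (𝓝 0) := by
  have hanti : Antitone (fun M => {p : (Site 1 → ℕ) × Stacks 1 | NoTop (bx M) p.1 0 p.2}) := by
    intro M N hMN p hp l hl'
    exact hp l (legal_init_mono (bx_mono hMN) _ _ _ hl')
  have hz : (PP lam ν) (⋂ M, {p : (Site 1 → ℕ) × Stacks 1 | NoTop (bx M) p.1 0 p.2}) = 0 := by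
    rw [ae_iff] at h
    refine measure_mono_null ?_ h
    intro p hp htop
    have hlt : (0 : ℕ∞) < odomAt 0 p.2 p.1 := by rw [htop]; exact ENat.top_pos
    obtain ⟨V, l, h1, h2⟩ := lt_odomAt.1 hlt
    have hV : V ⊆ bx (V.sup fun x => (x 0).natAbs) := by
      intro x hx
      have := Finset.le_sup (f := fun x : Site 1 => (x 0).natAbs) hx
      rw [mem_bx]
      omega
    have h3 := (Set.mem_iInter.1 hp _) l (legal_init_mono hV _ _ _ h1)
    rw [h3] at h2
    simp at h2
  have ht := tendsto_measure_iInter_atTop (μ := PP lam ν)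
    (fun M => (joint_noTop (bx M) 0).nullMeasurableSet) hanti ⟨0, measure_ne_top _ _⟩
  rw [hz] at ht
  have := (ENNReal.tendsto_toReal zero_ne_top).comp ht
  exact this

lemma fix_iff : Fixates 1 (ssrwStep 1) lam ν ↔ ∀ᵐ p ∂(PP lam ν), odomAt 0 p.2 p.1 ≠ ⊤ := by
  unfold Fixates
  rw [stackLaw_eq]
  exact (Measure.ae_prod_iff_ae_ae (odomAt_top_meas 0).compl).symm

theorem rho_ge (hν : IsTransErgodic ν) {ρ : ℝ} (hρ : 0 ≤ ρ)
    (hm : ∫⁻ η, (η 0 : ℝ≥0∞) ∂ν = ENNReal.ofReal ρ) {r : ℕ} (hr : 1 ≤ r)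
    (hlam : ∑ k ∈ offs r, (1 / lam * (1 / (k.natAbs : ℝ))) ≤ 1 / 2)
    (hnf : ¬ Fixates 1 (ssrwStep 1) lam ν) : 1 - 2 / (lam * r) ≤ ρ := by
  rw [fix_iff] at hnf
  have hpos : (PP lam ν) {p | odomAt 0 p.2 p.1 = ⊤} ≠ 0 := by
    intro h0
    apply hnf
    rw [ae_iff]
    simpa using h0
  let G : Set ((Site 1 → ℕ) × Stacks 1) := ⋃ x : Site 1, {p | odomAt x p.2 p.1 = ⊤}
  have hG : MeasurableSet G := MeasurableSet.iUnion fun x => odomAt_top_meas x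
  have hinv : ∀ z, shP z ⁻¹' G = G := by
    intro z
    ext p
    simp only [G, Set.mem_preimage, Set.mem_iUnion, Set.mem_ofPred_eq, shP, odomAt_shift]
    constructor
    · rintro ⟨x, h⟩; exact ⟨_, h⟩
    · rintro ⟨x, h⟩; exact ⟨x - z, by rwa [sub_add_cancel]⟩
  have h01 : (PP lam ν) G = 0 ∨ (PP lam ν) G = 1 := zero_one (instrM lam) ν hν G hG hinv
  have hG1 : (PP lam ν) G = 1 := by
    refine h01.resolve_left fun h0 => hpos (measure_mono_null ?_ h0)
    exact Set.subset_iUnion (fun x : Site 1 => {p : (Site 1 → ℕ) × Stacks 1 | odomAt x p.2 p.1 = ⊤}) 0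
  have hae : ∀ᵐ p ∂(PP lam ν), odomAt 0 p.2 p.1 = ⊤ := by
    have : ∀ᵐ p ∂(PP lam ν), p ∈ G := (mem_ae_iff_prob_eq_one hG).2 hG1
    filter_upwards [this, ae_reg' (lam := lam) (ν := ν)] with p h1 h2
    obtain ⟨x, hx⟩ := Set.mem_iUnion.1 h1
    exact odomAt_all h2 _ x hx 0
  have ht := qq_tendsto hae
  have ht2 : Tendsto (fun M : ℕ => 1 - (2 * (qq lam ν M 0 + 1 / (lam * r)) + (1 / 2 : ℝ) ^ M)) atTop
      (𝓝 (1 - (2 * (0 + 1 / (lam * r)) + 0))) :=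
    tendsto_const_nhds.sub (((ht.add_const _).const_mul _).add
      (tendsto_pow_atTop_nhds_zero_of_lt_one (by norm_num) (by norm_num)))
  have := le_of_tendsto ht2 (Eventually.of_forall fun M => rho_ge1 hν hρ hm hr hlam M M)
  calc 1 - 2 / (lam * r) = 1 - (2 * (0 + 1 / (lam * r)) + 0) := by ring
    _ ≤ ρ := this

end
end
end ARW

namespace ARW
noncomputable section
open scoped Classical
set_option linter.unusedSimpArgs false
set_option linter.unnecessarySeqFocus false
set_option linter.unusedSectionVars false

/-- the two-point law on `k`, `k + 1`. -/
def twoPt (k : ℕ) (p : ℝ) : Measure ℕ :=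
  ENNReal.ofReal (1 - p) • Measure.dirac k + ENNReal.ofReal p • Measure.dirac (k + 1)

/-- configuration read off from an array. -/
def rd (a : Site 1 × ℕ → ℕ) : Site 1 → ℕ := fun x => a (x, 0)

lemma rd_meas : Measurable rd := by unfold rd; fun_prop

/-- the product law. -/
def iid (k : ℕ) (p : ℝ) : Measure (Site 1 → ℕ) :=
  Measure.map rd (Measure.infinitePi (fun _ : Site 1 × ℕ => twoPt k p))

lemma twoPt_prob (k : ℕ) {p : ℝ} (h0 : 0 ≤ p) (h1 : p ≤ 1) : IsProbabilityMeasure (twoPt k p) := by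
  constructor
  simp only [twoPt, Measure.add_apply, Measure.smul_apply, measure_univ, smul_eq_mul, mul_one]
  rw [← ENNReal.ofReal_add (by linarith) h0]
  simp

lemma dirac_erg : IsTransErgodic (Measure.dirac (0 : Site 1 → ℕ)) := by
  refine ⟨fun z => ?_, fun s hs _ => ?_⟩
  · rw [Measure.map_dirac' (shift_meas z)]; rfl
  · rw [Measure.dirac_apply' _ hs]
    by_cases h : (0 : Site 1 → ℕ) ∈ s <;> simp [h]

lemma shift_rd (z : Site 1) (a : Site 1 × ℕ → ℕ) : shift z (rd a) = rd (shiftI z a) := rfl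

lemma iid_erg (k : ℕ) {p : ℝ} (h0 : 0 ≤ p) (h1 : p ≤ 1) : IsTransErgodic (iid k p) := by
  have := twoPt_prob k h0 h1
  refine ⟨fun z => ?_, fun s hs hinv => ?_⟩
  · unfold iid
    rw [Measure.map_map (shift_meas z) rd_meas]
    have : shift z ∘ rd = rd ∘ shiftI z := rfl
    rw [this, ← Measure.map_map rd_meas (shiftI_meas z), shiftI_map]
  · have h := zero_one (twoPt k p) (Measure.dirac (0 : Site 1 → ℕ)) dirac_erg
      {q | rd q.2 ∈ s} ((rd_meas.comp measurable_snd) hs) (by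
        intro z
        ext q
        have := congrArg (fun t => rd q.2 ∈ t) (hinv z)
        simp only [Set.mem_preimage, shift_rd, eq_iff_iff] at this
        exact this)
    have e : (Measure.dirac (0 : Site 1 → ℕ)).prod
        (Measure.infinitePi (fun _ : Site 1 × ℕ => twoPt k p)) {q | rd q.2 ∈ s} = iid k p s := by
      have hmm : MeasurableSet {q : (Site 1 → ℕ) × (Site 1 × ℕ → ℕ) | rd q.2 ∈ s} :=
        (rd_meas.comp measurable_snd) hs
      rw [iid, Measure.map_apply rd_meas hs, Measure.prod_apply hmm]
      have : ∀ η : Site 1 → ℕ, Prod.mk η ⁻¹' {q : (Site 1 → ℕ) × (Site 1 × ℕ → ℕ) | rd q.2 ∈ s} =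
        rd ⁻¹' s := fun η => rfl
      simp only [this]
      simp
    rwa [e] at h

lemma iid_prob (k : ℕ) {p : ℝ} (h0 : 0 ≤ p) (h1 : p ≤ 1) : IsProbabilityMeasure (iid k p) := by
  have := twoPt_prob k h0 h1
  unfold iid
  exact Measure.isProbabilityMeasure_map rd_meas.aemeasurable

lemma iid_map (k : ℕ) {p : ℝ} (h0 : 0 ≤ p) (h1 : p ≤ 1) (x : Site 1) :
    Measure.map (fun η : Site 1 → ℕ => η x) (iid k p) = twoPt k p := by
  have := twoPt_prob k h0 h1
  unfold iid
  rw [Measure.map_map (measurable_pi_apply x) rd_meas]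
  exact Measure.infinitePi_map_eval (fun _ : Site 1 × ℕ => twoPt k p) (x, 0)

lemma iid_mean (k : ℕ) {p : ℝ} (h0 : 0 ≤ p) (h1 : p ≤ 1) :
    ∫⁻ η, (η 0 : ℝ≥0∞) ∂(iid k p) = ENNReal.ofReal (k + p) := by
  have : ∫⁻ η, (η 0 : ℝ≥0∞) ∂(iid k p) = ∫⁻ n, (n : ℝ≥0∞) ∂(twoPt k p) := by
    rw [← iid_map k h0 h1 0, lintegral_map (by fun_prop) (measurable_pi_apply 0)]
  rw [this, twoPt, lintegral_add_measure, lintegral_smul_measure, lintegral_smul_measure,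
    lintegral_dirac, lintegral_dirac, ← ENNReal.ofReal_natCast, ← ENNReal.ofReal_natCast,
    smul_eq_mul, smul_eq_mul, ← ENNReal.ofReal_mul (by linarith), ← ENNReal.ofReal_mul h0,
    ← ENNReal.ofReal_add (mul_nonneg (by linarith) (by positivity)) (by positivity)]
  congr 1
  push_cast
  ring

lemma iid_bdd (k : ℕ) {p : ℝ} (h0 : 0 ≤ p) (h1 : p ≤ 1) :
    ∀ᵐ η ∂(iid k p), ∀ x : Site 1, η x ≤ k + 1 := by
  rw [ae_all_iff]
  intro x
  have h : ∀ᵐ n ∂(twoPt k p), n ≤ k + 1 := by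
    rw [ae_iff]
    simp [twoPt]
  rw [← iid_map k h0 h1 x] at h
  exact ae_of_ae_map (measurable_pi_apply x).aemeasurable h

section
variable {lam : ℝ} [hl : Fact (0 < lam)] {ν : Measure (Site 1 → ℕ)} [IsProbabilityMeasure ν]

lemma count_loss {L k n : ℕ} {I : Stacks 1} (hI : Reg I) {η : Site 1 → ℕ} (hη : ∀ x, η x ≤ k + 1) :
    ∑ x ∈ bx L, η x ≤ (2 * L + 1) + 2 * n + k * (2 * L + 1) *
      ((if (n : ℕ∞) < odomAt (pt L) I η then 1 else 0) +
        (if (n : ℕ∞) < odomAt (pt (-L)) I η then 1 else 0)) := by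
  have hmax : ∑ x ∈ bx L, η x ≤ (2 * L + 1) * (k + 1) := by
    calc ∑ x ∈ bx L, η x ≤ ∑ x ∈ bx L, (k + 1) := Finset.sum_le_sum fun x _ => hη x
      _ = _ := by rw [Finset.sum_const, card_bx, smul_eq_mul]
  by_cases hA : (n : ℕ∞) < odomAt (pt L) I η
  · rw [if_pos hA]
    split_ifs <;> nlinarith
  by_cases hB : (n : ℕ∞) < odomAt (pt (-L)) I η
  · rw [if_pos hB, if_neg hA]
    nlinarith
  rw [if_neg hA, if_neg hB]
  obtain ⟨l, h1, h2⟩ := exists_stab (L := L) hI η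
  have h3 := loss_run hI (∑ x ∈ bx L, η x) l _ h1 (by
    rw [sum_cnt_init]; omega)
  rw [run_odom, run_odom] at h3
  have hc : ∑ w ∈ bx L, cnt ((run (bx L) I (initState 1 (bx L) η) l).1 w) ≤ 2 * L + 1 := by
    calc _ ≤ ∑ x ∈ bx L, 1 := Finset.sum_le_sum fun x hx => (stable_cnt (h2 x hx)).1
      _ = _ := by rw [Finset.sum_const, card_bx, smul_eq_mul, mul_one]
  have ha : l.count (pt L) ≤ n := by
    have := (le_odomAt (x := pt L) h1).trans (not_lt.1 hA)
    exact_mod_cast this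
  have hb : l.count (pt (-L)) ≤ n := by
    have := (le_odomAt (x := pt (-L)) h1).trans (not_lt.1 hB)
    exact_mod_cast this
  have e1 : (initState 1 (bx L) η).2 (pt L) = 0 := rfl
  have e2 : (initState 1 (bx L) η).2 (pt (-L)) = 0 := rfl
  rw [e1, e2] at h3
  omega

lemma odom_shift_prob (hν : IsTransErgodic ν) (x : Site 1) (n : ℕ) :
    (PP lam ν) {q | (n : ℕ∞) < odomAt x q.2 q.1} = (PP lam ν) {q | (n : ℕ∞) < odomAt 0 q.2 q.1} := by
  rw [← (PP_pres (lam := lam) hν x).measure_preimage (odomAt_gt_meas 0 n).nullMeasurableSet]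
  congr 1
  ext q
  simp only [Set.mem_preimage, Set.mem_ofPred_eq, shP, odomAt_shift, zero_add]

lemma loss_mean (hν : IsTransErgodic ν) {ρ : ℝ} (hρ : 0 ≤ ρ)
    (hm : ∫⁻ η, (η 0 : ℝ≥0∞) ∂ν = ENNReal.ofReal ρ) {k : ℕ} (hk : ∀ᵐ η ∂ν, ∀ x, η x ≤ k + 1)
    (L n : ℕ) : (2 * L + 1) * ρ ≤ (2 * L + 1) + 2 * n + k * (2 * L + 1) *
      (2 * (PP lam ν).real {q | (n : ℕ∞) < odomAt 0 q.2 q.1}) := by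
  have hk' : ∀ᵐ q ∂(PP lam ν), ∀ x, q.1 x ≤ k + 1 :=
    (Measure.quasiMeasurePreserving_fst (μ := ν) (ν := Mu lam)).ae hk
  have hmeas := fun x => odomAt_gt_meas x n
  have h2 : ENNReal.ofReal ((2 * L + 1) * ρ) ≤ (2 * L + 1) + 2 * n + k * (2 * L + 1) *
      (2 * (PP lam ν) {q | (n : ℕ∞) < odomAt 0 q.2 q.1}) := by
    calc ENNReal.ofReal ((2 * L + 1) * ρ) = ∑ x ∈ bx L, ENNReal.ofReal ρ := by
          rw [Finset.sum_const, card_bx, nsmul_eq_mul, ENNReal.ofReal_mul (by positivity)]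
          congr 1
          rw [show (2 * (L : ℝ) + 1) = ((2 * L + 1 : ℕ) : ℝ) by push_cast; ring,
            ENNReal.ofReal_natCast]
      _ = ∑ x ∈ bx L, ∫⁻ q, (q.1 x : ℝ≥0∞) ∂(PP lam ν) := by
          refine Finset.sum_congr rfl fun x _ => ?_
          rw [← hm, ← mean_site hν x, PP, lintegral_prod _ (by fun_prop)]
          simp
      _ = ∫⁻ q, ∑ x ∈ bx L, (q.1 x : ℝ≥0∞) ∂(PP lam ν) := by
          rw [lintegral_finsetSum]
          intro x _
          fun_prop
      _ ≤ ∫⁻ q, ((2 * L + 1) + 2 * n + k * (2 * L + 1) *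
          (Set.indicator {q | (n : ℕ∞) < odomAt (pt L) q.2 q.1} 1 q +
          Set.indicator {q | (n : ℕ∞) < odomAt (pt (-L)) q.2 q.1} 1 q)) ∂(PP lam ν) := by
          refine lintegral_mono_ae ?_
          filter_upwards [ae_reg' (lam := lam) (ν := ν), hk'] with q h1 h2
          have := count_loss (L := L) (k := k) (n := n) h1 h2
          have h' : ((∑ x ∈ bx L, q.1 x : ℕ) : ℝ≥0∞) ≤ _ := Nat.cast_le.2 this
          push_cast at h'
          simpa only [Set.indicator_apply, Set.mem_ofPred_eq, Pi.one_apply] using h'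
      _ = (2 * L + 1) + 2 * n + k * (2 * L + 1) *
          ((PP lam ν) {q | (n : ℕ∞) < odomAt (pt L) q.2 q.1} +
          (PP lam ν) {q | (n : ℕ∞) < odomAt (pt (-L)) q.2 q.1}) := by
          have i1 : ∀ x, Measurable (Set.indicator {q : (Site 1 → ℕ) × Stacks 1 |
              (n : ℕ∞) < odomAt x q.2 q.1} (1 : (Site 1 → ℕ) × Stacks 1 → ℝ≥0∞)) :=
            fun x => measurable_one.indicator (hmeas x)
          have i2 : Measurable (fun q => Set.indicator {q : (Site 1 → ℕ) × Stacks 1 |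
              (n : ℕ∞) < odomAt (pt L) q.2 q.1} (1 : (Site 1 → ℕ) × Stacks 1 → ℝ≥0∞) q +
              Set.indicator {q : (Site 1 → ℕ) × Stacks 1 |
              (n : ℕ∞) < odomAt (pt (-L)) q.2 q.1} (1 : (Site 1 → ℕ) × Stacks 1 → ℝ≥0∞) q) :=
            (i1 _).add (i1 _)
          rw [lintegral_add_left measurable_const, lintegral_const_mul _ i2,
            lintegral_add_left (i1 _),
            lintegral_indicator_one (hmeas _), lintegral_indicator_one (hmeas _)]
          simp
      _ = _ := by
          rw [odom_shift_prob hν (pt L), odom_shift_prob hν (pt (-L)), ← two_mul ((PP lam ν) _)]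
  have hu : (PP lam ν) {q | (n : ℕ∞) < odomAt 0 q.2 q.1} =
      ENNReal.ofReal ((PP lam ν).real {q | (n : ℕ∞) < odomAt 0 q.2 q.1}) :=
    (ENNReal.ofReal_toReal (measure_ne_top _ _)).symm
  have hu0 : 0 ≤ (PP lam ν).real {q | (n : ℕ∞) < odomAt 0 q.2 q.1} := measureReal_nonneg
  rw [hu] at h2
  set u := (PP lam ν).real {q | (n : ℕ∞) < odomAt 0 q.2 q.1} with hudef
  have e : ((2 * L + 1) + 2 * n + k * (2 * L + 1) * (2 * ENNReal.ofReal u) : ℝ≥0∞) =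
      ENNReal.ofReal ((2 * L + 1) + 2 * n + k * (2 * L + 1) * (2 * u)) := by
    have e1 : ((2 * L + 1) + 2 * n : ℝ≥0∞) = ENNReal.ofReal ((2 * L + 1) + 2 * n) := by
      rw [← ENNReal.ofReal_natCast L, ← ENNReal.ofReal_natCast n, ENNReal.ofReal_add (by positivity)
        (by positivity), ENNReal.ofReal_add (by positivity) (by positivity),
        ENNReal.ofReal_mul (by positivity), ENNReal.ofReal_mul (by positivity)]
      simp
    have e2 : (k * (2 * L + 1) * (2 * ENNReal.ofReal u) : ℝ≥0∞) =
        ENNReal.ofReal (k * (2 * L + 1) * (2 * u)) := by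
      rw [← ENNReal.ofReal_natCast L, ← ENNReal.ofReal_natCast k, ENNReal.ofReal_mul (by positivity),
        ENNReal.ofReal_mul (by positivity), ENNReal.ofReal_add (by positivity) (by positivity),
        ENNReal.ofReal_mul (by positivity), ENNReal.ofReal_mul (by positivity)]
      simp
    rw [e1, e2, ← ENNReal.ofReal_add (by positivity) (by positivity)]
  rw [e] at h2
  exact (ENNReal.ofReal_le_ofReal_iff (by positivity)).1 h2

theorem not_fix (hν : IsTransErgodic ν) {ρ : ℝ} (hρ : 1 < ρ)
    (hm : ∫⁻ η, (η 0 : ℝ≥0∞) ∂ν = ENNReal.ofReal ρ) {k : ℕ} (hk : ∀ᵐ η ∂ν, ∀ x, η x ≤ k + 1) :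
    ¬ Fixates 1 (ssrwStep 1) lam ν := by
  rw [fix_iff]
  intro hf
  have hz : (PP lam ν) (⋂ n : ℕ, {q | (n : ℕ∞) < odomAt 0 q.2 q.1}) = 0 := by
    rw [← odomAt_top_eq]
    rw [ae_iff] at hf
    simpa using hf
  have hanti : Antitone (fun n : ℕ => {q : (Site 1 → ℕ) × Stacks 1 | (n : ℕ∞) < odomAt 0 q.2 q.1}) := by
    intro a b hab q hq
    have hab' : (a : ℕ∞) ≤ b := by exact_mod_cast hab
    have hq' : (b : ℕ∞) < odomAt 0 q.2 q.1 := hq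
    exact lt_of_le_of_lt hab' hq'
  have ht := tendsto_measure_iInter_atTop (μ := PP lam ν)
    (fun n => (odomAt_gt_meas 0 n).nullMeasurableSet) hanti ⟨0, measure_ne_top _ _⟩
  rw [hz] at ht
  have ht2 : Tendsto (fun n : ℕ => (PP lam ν).real {q | (n : ℕ∞) < odomAt 0 q.2 q.1}) atTop (𝓝 0) :=
    (ENNReal.tendsto_toReal zero_ne_top).comp ht
  set c := (ρ - 1) / 2 with hc
  have hc0 : 0 < c := by rw [hc]; linarith
  have hn : Tendsto (fun L : ℕ => ⌊c * L⌋₊) atTop atTop :=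
    tendsto_nat_floor_atTop.comp (tendsto_natCast_atTop_atTop.const_mul_atTop hc0)
  have ht3 := (ht2.comp hn).const_mul (2 * (k : ℝ))
  rw [mul_zero] at ht3
  have hge : ∀ L : ℕ, c ≤ 2 * (k : ℝ) * (((fun n : ℕ =>
      (PP lam ν).real {q | (n : ℕ∞) < odomAt 0 q.2 q.1}) ∘ (fun L : ℕ => ⌊c * L⌋₊)) L) := by
    intro L
    have h := loss_mean (lam := lam) hν (by linarith) hm hk L ⌊c * L⌋₊
    have hfl : (⌊c * L⌋₊ : ℝ) ≤ c * L := Nat.floor_le (by positivity)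
    simp only [Function.comp]
    set u := (PP lam ν).real {q | ((⌊c * L⌋₊ : ℕ) : ℕ∞) < odomAt 0 q.2 q.1}
    have hpos : (0 : ℝ) < 2 * L + 1 := by positivity
    have hr : ρ = 1 + 2 * c := by rw [hc]; ring
    have : (2 * (L : ℝ) + 1) * c ≤ (2 * L + 1) * (2 * k * u) := by
      rw [hr] at h
      nlinarith
    exact le_of_mul_le_mul_left this hpos
  have := ge_of_tendsto' ht3 hge
  linarith

end

theorem crit_set_le {lam : ℝ} (hlam : 0 < lam) {ρ : ℝ}
    (h : ∀ ν : Measure (Site 1 → ℕ), IsProbabilityMeasure ν → IsTransErgodic ν →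
      (∫⁻ η, (η 0 : ℝ≥0∞) ∂ν) = ENNReal.ofReal ρ → Fixates 1 (ssrwStep 1) lam ν) : ρ ≤ 1 := by
  by_contra hc
  push Not at hc
  have : Fact (0 < lam) := ⟨hlam⟩
  have h0 : 0 ≤ ρ - ⌊ρ⌋₊ := sub_nonneg.2 (Nat.floor_le (by linarith))
  have h1 : ρ - ⌊ρ⌋₊ ≤ 1 := by have := Nat.lt_floor_add_one ρ; linarith
  have hm := iid_mean ⌊ρ⌋₊ h0 h1
  rw [add_sub_cancel] at hm
  have := iid_prob ⌊ρ⌋₊ h0 h1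
  exact not_fix (lam := lam) (iid_erg _ h0 h1) hc hm (iid_bdd _ h0 h1)
    (h _ (iid_prob _ h0 h1) (iid_erg _ h0 h1) hm)

theorem crit_bounds {lam : ℝ} (hlam : 0 < lam) {r : ℕ} (hr : 1 ≤ r)
    (hs : ∑ k ∈ offs r, (1 / lam * (1 / (k.natAbs : ℝ))) ≤ 1 / 2) :
    1 - 2 / (lam * r) ≤ critDensity 1 (ssrwStep 1) lam ∧ critDensity 1 (ssrwStep 1) lam ≤ 1 := by
  have : Fact (0 < lam) := ⟨hlam⟩
  unfold critDensity
  set S := {ρ : ℝ | 0 ≤ ρ ∧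
    ∀ ν : Measure (Site 1 → ℕ), IsProbabilityMeasure ν → IsTransErgodic ν →
      (∫⁻ η, (η 0 : ℝ≥0∞) ∂ν) = ENNReal.ofReal ρ → Fixates 1 (ssrwStep 1) lam ν} with hS
  have hub : ∀ ρ ∈ S, ρ ≤ 1 := fun ρ h => crit_set_le hlam h.2
  have hb : BddAbove S := ⟨1, hub⟩
  have hmem : ∀ ρ, 0 ≤ ρ → ρ < 1 - 2 / (lam * r) → ρ ∈ S := by
    intro ρ h0 h1
    refine ⟨h0, fun ν hp he hm => ?_⟩
    by_contra hc
    have := rho_ge (lam := lam) he h0 hm hr hs hc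
    linarith
  constructor
  · by_cases hneg : 1 - 2 / (lam * r) ≤ 0
    · refine hneg.trans (Real.sSup_nonneg fun ρ h => h.1)
    · push Not at hneg
      refine le_of_forall_lt fun c hcl => ?_
      obtain ⟨ρ, h1, h2⟩ := exists_between (max_lt hcl hneg)
      exact lt_of_lt_of_le ((le_max_left _ _).trans_lt h1)
        (le_csSup hb (hmem ρ ((le_max_right _ _).trans h1.le) h2))
  · exact Real.sSup_le hub zero_le_one

end
end ARW

namespace ARW
noncomputable section
open scoped Classical
set_option linter.unusedSimpArgs false
set_option linter.unnecessarySeqFocus false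

lemma offs_sum_le (r : ℕ) : ∑ k ∈ offs r, (1 / (k.natAbs : ℝ)) ≤ 2 * (1 + Real.log r) := by
  have hsub : offs r ⊆ ((Finset.range r).image (fun i : ℕ => ((i : ℤ) + 1))) ∪
      ((Finset.range r).image (fun i : ℕ => (-((i : ℤ) + 1)))) := by
    intro k hk
    simp only [offs, Finset.mem_erase, Finset.mem_Ioo] at hk
    rw [Finset.mem_union, Finset.mem_image, Finset.mem_image]
    rcases lt_or_gt_of_ne hk.1 with h | h
    · right
      exact ⟨k.natAbs - 1, Finset.mem_range.2 (by omega), by omega⟩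
    · left
      exact ⟨k.natAbs - 1, Finset.mem_range.2 (by omega), by omega⟩
  have hh : ∑ i ∈ Finset.range r, (1 / ((i : ℝ) + 1)) ≤ 1 + Real.log r := by
    have := harmonic_le_one_add_log r
    rw [harmonic] at this
    push_cast at this
    simpa [one_div] using this
  have h1 : ∑ k ∈ (Finset.range r).image (fun i : ℕ => ((i : ℤ) + 1)), (1 / (k.natAbs : ℝ)) =
      ∑ i ∈ Finset.range r, (1 / ((i : ℝ) + 1)) := by
    rw [Finset.sum_image (fun a _ b _ h => by simpa using h)]
    refine Finset.sum_congr rfl fun i _ => ?_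
    have : ((i : ℤ) + 1).natAbs = i + 1 := by omega
    rw [this]; push_cast; rfl
  have h2 : ∑ k ∈ (Finset.range r).image (fun i : ℕ => (-((i : ℤ) + 1))), (1 / (k.natAbs : ℝ)) =
      ∑ i ∈ Finset.range r, (1 / ((i : ℝ) + 1)) := by
    rw [Finset.sum_image (fun a _ b _ h => by simpa using h)]
    refine Finset.sum_congr rfl fun i _ => ?_
    have : (-((i : ℤ) + 1)).natAbs = i + 1 := by omega
    rw [this]; push_cast; rfl
  have h3 := Finset.sum_union_inter
    (s₁ := (Finset.range r).image (fun i : ℕ => ((i : ℤ) + 1)))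
    (s₂ := (Finset.range r).image (fun i : ℕ => (-((i : ℤ) + 1))))
    (f := fun k : ℤ => (1 / (k.natAbs : ℝ)))
  have h4 : 0 ≤ ∑ k ∈ ((Finset.range r).image (fun i : ℕ => ((i : ℤ) + 1))) ∩
      ((Finset.range r).image (fun i : ℕ => (-((i : ℤ) + 1)))), (1 / (k.natAbs : ℝ)) :=
    Finset.sum_nonneg fun k _ => by positivity
  have h5 := Finset.sum_le_sum_of_subset_of_nonneg hsub
    (f := fun k : ℤ => (1 / (k.natAbs : ℝ))) (fun k _ _ => by positivity)
  linarith

lemma main_bound (n : ℕ) {lam : ℝ} (h1 : 1 ≤ lam)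
    (hlog : 2 * (1 + (Real.log 2 + n * Real.log lam)) ≤ lam / 2) :
    0 ≤ lam ^ n * (1 - critDensity 1 (ssrwStep 1) lam) ∧
      lam ^ n * (1 - critDensity 1 (ssrwStep 1) lam) ≤ 2 / lam := by
  have hl : 0 < lam := by linarith
  have hp : 1 ≤ lam ^ n := one_le_pow₀ h1
  set r := ⌈lam ^ n⌉₊ with hr
  have hr0 : lam ^ n ≤ r := Nat.le_ceil _
  have hr1 : (1 : ℝ) ≤ r := hp.trans hr0
  have hr1' : 1 ≤ r := by exact_mod_cast hr1
  have hr2 : (r : ℝ) ≤ 2 * lam ^ n := by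
    have := Nat.ceil_lt_add_one (show 0 ≤ lam ^ n by linarith)
    linarith
  have hlr : Real.log r ≤ Real.log 2 + n * Real.log lam := by
    rw [← Real.log_pow, ← Real.log_mul (by norm_num) (by positivity)]
    exact Real.log_le_log (by linarith) hr2
  have hs : ∑ k ∈ offs r, (1 / lam * (1 / (k.natAbs : ℝ))) ≤ 1 / 2 := by
    rw [← Finset.mul_sum]
    have h2 : ∑ k ∈ offs r, (1 / (k.natAbs : ℝ)) ≤ lam / 2 := (offs_sum_le r).trans (by linarith)
    calc 1 / lam * ∑ k ∈ offs r, (1 / (k.natAbs : ℝ)) ≤ 1 / lam * (lam / 2) := by gcongr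
      _ = 1 / 2 := by field_simp
  obtain ⟨ha, hb⟩ := crit_bounds hl hr1' hs
  refine ⟨mul_nonneg (by positivity) (by linarith), ?_⟩
  calc lam ^ n * (1 - critDensity 1 (ssrwStep 1) lam) ≤ r * (2 / (lam * r)) := by
        refine mul_le_mul hr0 (by linarith) (by linarith) (by positivity)
    _ = 2 / lam := by field_simp

lemma ev_log (n : ℕ) :
    ∀ᶠ lam : ℝ in atTop, 2 * (1 + (Real.log 2 + n * Real.log lam)) ≤ lam / 2 := by
  have h := (Real.isLittleO_log_id_atTop).const_mul_left (2 * (n : ℝ))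
  have h1 := h.bound (show (0 : ℝ) < 1 / 4 by norm_num)
  filter_upwards [h1, eventually_ge_atTop (8 * (1 + Real.log 2)), eventually_ge_atTop 1] with lam a b c
  simp only [id, Real.norm_eq_abs] at a
  rw [abs_of_nonneg (show 0 ≤ lam by linarith)] at a
  have := le_abs_self (2 * (n : ℝ) * Real.log lam)
  linarith

end
end ARW

theorem arw_high_sleep_superpolynomial_dim1 (n : ℕ) (hn : 1 ≤ n) :
    Tendsto (fun lam : ℝ => lam ^ n * (1 - critDensity 1 (ssrwStep 1) lam))
      atTop (𝓝 0) := by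
  have h2 : Tendsto (fun lam : ℝ => 2 / lam) atTop (𝓝 0) := tendsto_id.const_div_atTop 2
  have hb : ∀ᶠ lam : ℝ in atTop, 0 ≤ lam ^ n * (1 - critDensity 1 (ssrwStep 1) lam) ∧
      lam ^ n * (1 - critDensity 1 (ssrwStep 1) lam) ≤ 2 / lam := by
    filter_upwards [ev_log n, eventually_ge_atTop 1] with lam a b
    exact main_bound n b a
  exact tendsto_of_tendsto_of_tendsto_of_le_of_le' tendsto_const_nhds h2
    (hb.mono fun _ h => h.1) (hb.mono fun _ h => h.2)
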